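/- arXiv:1202.2949 — 5 statements merged into one kernel-verified Lean document; each statement's English description precedes it below -/
import Mathlib

section
/- Let F : ℝ^n → ℝ^n be an everywhere defined real rational map whose Jacobian determinant vanishes nowhere on ℝ^n, and let d be the (finite) degree of the field extension ℝ(F) ⊆ ℝ(x_1, …, x_n). Then every fiber F^{-1}(y) is finite with at most d elements; the maximum N of the cardinalities of the fibers of F is attained and satisfies 1 ≤ N ≤ d; and d − N is even. In particular, if F is injective then d is odd. -/
/-- `F : ℝⁿ → ℝⁿ` is an everywhere defined real rational map with components corresponding
to the rational functions `f i ∈ ℝ(x₁, …, xₙ)`. -/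
def IsEverywhereDefRatMap (n : ℕ) (F : (Fin n → ℝ) → (Fin n → ℝ))
    (f : Fin n → FractionRing (MvPolynomial (Fin n) ℝ)) : Prop :=
  ∀ i : Fin n, ∃ p q : MvPolynomial (Fin n) ℝ,
    (∀ x : Fin n → ℝ, MvPolynomial.eval x q ≠ 0) ∧
    f i = algebraMap (MvPolynomial (Fin n) ℝ) (FractionRing (MvPolynomial (Fin n) ℝ)) p /
      algebraMap (MvPolynomial (Fin n) ℝ) (FractionRing (MvPolynomial (Fin n) ℝ)) q ∧
    ∀ x : Fin n → ℝ, F x i = MvPolynomial.eval x p / MvPolynomial.eval x q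

theorem fbp_exists_generic {n : ℕ} (g : MvPolynomial (Fin n) ℝ) (hg : g ≠ 0) (y : Fin n → ℝ)
    (V : Set (Fin n → ℝ)) (hV : V ∈ nhds y) : ∃ z ∈ V, MvPolynomial.eval z g ≠ 0 := by
  by_contra! h
  apply hg
  rw [nhds_pi, Filter.mem_pi] at hV
  obtain ⟨I, hI, t, ht, hsub⟩ := hV
  refine MvPolynomial.funext_set t (fun i => ?_) (fun x hx => ?_)
  · exact infinite_of_mem_nhds (y i) (ht i)
  · rw [map_zero]
    exact h x (hsub (fun i _ => hx i trivial))

theorem fbp_contDiff {n : ℕ} (F : (Fin n → ℝ) → (Fin n → ℝ)) (p q : Fin n → MvPolynomial (Fin n) ℝ)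
    (hq : ∀ i x, MvPolynomial.eval x (q i) ≠ 0)
    (hF : ∀ i x, F x i = MvPolynomial.eval x (p i) / MvPolynomial.eval x (q i)) :
    ContDiff ℝ 1 F := by
  have key : ∀ p : MvPolynomial (Fin n) ℝ, ContDiff ℝ 1 (fun x => MvPolynomial.eval x p) := by
    intro p
    induction p using MvPolynomial.induction_on with
    | C a => simpa using contDiff_const
    | add p q hp hq => simpa using hp.add hq
    | mul_X p i hp => simpa using hp.mul (contDiff_apply ℝ ℝ i)
  rw [contDiff_pi]
  intro i
  simp only [hF i]
  exact (key _).div (key _) (hq i)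

theorem fbp_map_nhds {n : ℕ} (F : (Fin n → ℝ) → (Fin n → ℝ)) (hF : ContDiff ℝ 1 F)
    (hjac : ∀ x : Fin n → ℝ, (fderiv ℝ F x).det ≠ 0) (x : Fin n → ℝ) :
    Filter.map F (nhds x) = nhds (F x) := by
  have h1 : HasStrictFDerivAt F (fderiv ℝ F x) x :=
    (hF.contDiffAt).hasStrictFDerivAt (by simp)
  apply h1.map_nhds_eq_of_surj
  have : IsUnit (LinearMap.det (fderiv ℝ F x : (Fin n → ℝ) →ₗ[ℝ] (Fin n → ℝ))) :=
    isUnit_iff_ne_zero.mpr (hjac x)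
  exact LinearMap.range_eq_top.mpr (LinearEquiv.ofIsUnitDet (v := Pi.basisFun ℝ _) (v' := Pi.basisFun ℝ _) (f := (fderiv ℝ F x : (Fin n → ℝ) →ₗ[ℝ] (Fin n → ℝ))) (by rwa [LinearMap.det_toMatrix])).surjective

theorem fbp_lower {n : ℕ} (F : (Fin n → ℝ) → (Fin n → ℝ))
    (hF : ∀ x, Filter.map F (nhds x) = nhds (F x)) (y : Fin n → ℝ) (s : Finset (Fin n → ℝ))
    (hs : ∀ x ∈ s, F x = y) :
    ∃ V ∈ nhds y, ∀ z ∈ V, (F ⁻¹' {z}).Finite → s.card ≤ (F ⁻¹' {z}).ncard := by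
  obtain ⟨U, hU, hd⟩ := s.finite_toSet.t2_separation
  refine ⟨⋂ x ∈ s, F '' U x, ?_, ?_⟩
  · rw [Filter.biInter_finset_mem]
    intro x hx
    rw [← hs x hx, ← hF x]
    exact Filter.image_mem_map ((hU x).2.mem_nhds (hU x).1)
  · intro z hz hfin
    simp only [Set.mem_iInter] at hz
    choose! g hg using hz
    rw [← Set.ncard_coe_finset]
    refine Set.ncard_le_ncard_of_injOn g (fun x hx => (hg x hx).2) ?_ hfin
    intro a ha b hb hab
    by_contra hne
    have := hd ha hb hne
    exact Set.disjoint_left.mp this (hg a ha).1 (hab ▸ (hg b hb).1)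

theorem fbp_parity (p : Polynomial ℝ) (hp : p ≠ 0) :
    ∃ k, p.natDegree = Multiset.card p.roots + 2 * k := by
  induction p using WfDvdMonoid.induction_on_irreducible with
  | zero => exact absurd rfl hp
  | unit x hx =>
    refine ⟨0, ?_⟩
    obtain ⟨r, hr, rfl⟩ := Polynomial.isUnit_iff.mp hx
    simp
  | mul a i ha hi ih =>
    obtain ⟨k, hk⟩ := ih ha
    rw [Polynomial.natDegree_mul hi.ne_zero ha, Polynomial.roots_mul hp, Multiset.card_add]
    have h2 := hi.natDegree_le_two
    have h0 := hi.natDegree_pos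
    obtain h | h : i.natDegree = 1 ∨ i.natDegree = 2 := by omega
    · have : Multiset.card i.roots = 1 := by
        rw [Polynomial.roots_degree_eq_one ((Polynomial.degree_eq_iff_natDegree_eq hi.ne_zero).mpr h)]
        simp
      exact ⟨k, by omega⟩
    · have : i.roots = 0 := by
        exact Polynomial.roots_eq_zero_of_irreducible_of_natDegree_ne_one hi (by omega)
      exact ⟨k + 1, by simp [this]; omega⟩

open MvPolynomial in
/-- The local ring of fractions in `f` that are regular at `y`, with their values. -/
def fbpG {n : ℕ} {L : Type} [Field L] [Algebra ℝ L] (f : Fin n → L) (y : Fin n → ℝ) :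
    Subalgebra ℝ (L × ℝ) where
  carrier := {z | ∃ a b : MvPolynomial (Fin n) ℝ, eval y b ≠ 0 ∧
    z.1 * aeval f b = aeval f a ∧ z.2 * eval y b = eval y a}
  mul_mem' := by
    rintro ⟨k, r⟩ ⟨k', r'⟩ ⟨a, b, h0, h1, h2⟩ ⟨a', b', h0', h1', h2'⟩
    refine ⟨a * a', b * b', by simp [h0, h0'], ?_, ?_⟩
    · simp only [map_mul, Prod.mk_mul_mk, ← h1, ← h1']; ring
    · simp only [map_mul, Prod.mk_mul_mk, ← h2, ← h2']; ring
  add_mem' := by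
    rintro ⟨k, r⟩ ⟨k', r'⟩ ⟨a, b, h0, h1, h2⟩ ⟨a', b', h0', h1', h2'⟩
    refine ⟨a * b' + a' * b, b * b', by simp [h0, h0'], ?_, ?_⟩
    · simp only [map_mul, map_add, Prod.mk_add_mk, ← h1, ← h1']; ring
    · simp only [map_mul, map_add, Prod.mk_add_mk, ← h2, ← h2']; ring
  algebraMap_mem' := by
    intro r
    refine ⟨C r, 1, by simp, ?_, ?_⟩ <;> simp

/-- first projection -/
def fbpA {n : ℕ} {L : Type} [Field L] [Algebra ℝ L] (f : Fin n → L) (y : Fin n → ℝ) :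
    fbpG f y →ₐ[ℝ] L := (AlgHom.fst ℝ L ℝ).comp (fbpG f y).val

/-- second projection -/
def fbpB {n : ℕ} {L : Type} [Field L] [Algebra ℝ L] (f : Fin n → L) (y : Fin n → ℝ) :
    fbpG f y →ₐ[ℝ] ℝ := (AlgHom.snd ℝ L ℝ).comp (fbpG f y).val

section fbp
variable {n : ℕ} {L : Type} [Field L] [Algebra ℝ L]

theorem fbpA_inj (f : Fin n → L) (hf : AlgebraicIndependent ℝ f) (y : Fin n → ℝ) :
    Function.Injective (fbpA f y) := by
  rw [injective_iff_map_eq_zero]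
  rintro ⟨⟨k, r⟩, a, b, h0, h1, h2⟩ hk
  change k = 0 at hk
  subst hk
  simp only [zero_mul] at h1 h2
  have ha : a = 0 := by
    apply hf
    rw [← h1, map_zero]
  subst ha
  simp only [map_zero, mul_eq_zero, h0, or_false] at h2
  subst h2
  rfl

theorem fbpG_mem_gen (f : Fin n → L) (y : Fin n → ℝ) (i : Fin n) : (f i, y i) ∈ fbpG f y :=
  ⟨MvPolynomial.X i, 1, by simp, by simp, by simp⟩

theorem fbpG_mem_div (f : Fin n → L) (y : Fin n → ℝ) (k : L) (r : ℝ)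
    (k' : L) (r' : ℝ) (hf : AlgebraicIndependent ℝ f)
    (h : (k, r) ∈ fbpG f y) (h' : (k', r') ∈ fbpG f y) (hr : r' ≠ 0) :
    (k / k', r / r') ∈ fbpG f y := by
  obtain ⟨a, b, h0, h1, h2⟩ := h
  obtain ⟨a', b', h0', h1', h2'⟩ := h'
  simp only at h1 h2 h1' h2'
  have ha' : MvPolynomial.eval y a' ≠ 0 := by rw [← h2']; exact mul_ne_zero hr h0'
  have hk : MvPolynomial.aeval f a' ≠ 0 := by
    intro h
    have : a' = 0 := hf (by rw [h, map_zero])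
    exact ha' (by rw [this, map_zero])
  have hk' : k' ≠ 0 := by
    rintro rfl
    exact hk (by rw [← h1', zero_mul])
  refine ⟨a * b', b * a', ?_, ?_, ?_⟩
  · rw [map_mul]; exact mul_ne_zero h0 ha'
  · simp only [map_mul, ← h1, ← h1']; field_simp
  · simp only [map_mul, ← h2, ← h2']; field_simp

theorem fbpG_le (f g : Fin n → L) (y x : Fin n → ℝ) (hf : AlgebraicIndependent ℝ f)
    (hg : AlgebraicIndependent ℝ g) (h : ∀ i, (f i, y i) ∈ fbpG g x) : fbpG f y ≤ fbpG g x := by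
  have key : ∀ a : MvPolynomial (Fin n) ℝ,
      (MvPolynomial.aeval f a, MvPolynomial.eval y a) ∈ fbpG g x := by
    intro a
    induction a using MvPolynomial.induction_on with
    | C r => simpa using (fbpG g x).algebraMap_mem r
    | add p q hp hq => simpa using (fbpG g x).add_mem hp hq
    | mul_X p i hp => simpa using (fbpG g x).mul_mem hp (h i)
  rintro ⟨k, r⟩ ⟨a, b, h0, h1, h2⟩
  have hb : MvPolynomial.aeval f b ≠ 0 := by
    intro h
    have : b = 0 := hf (by rw [h, map_zero])
    exact h0 (by rw [this, map_zero])
  have := fbpG_mem_div g x _ _ _ _ hg (key a) (key b) h0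
  simp only at h1 h2
  rwa [← h1, ← h2, mul_div_cancel_right₀ _ hb, mul_div_cancel_right₀ _ h0] at this

/-- the filter of generic sets -/
def fbpGen (n : ℕ) : Filter (Fin n → ℝ) where
  sets := {S | ∃ g : MvPolynomial (Fin n) ℝ, g ≠ 0 ∧ ∀ y, MvPolynomial.eval y g ≠ 0 → y ∈ S}
  univ_sets := ⟨1, one_ne_zero, fun _ _ => trivial⟩
  sets_of_superset := by
    rintro S T ⟨g, h0, h⟩ hST
    exact ⟨g, h0, fun y hy => hST (h y hy)⟩
  inter_sets := by
    rintro S T ⟨g, h0, h⟩ ⟨g', h0', h'⟩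
    refine ⟨g * g', mul_ne_zero h0 h0', fun y hy => ?_⟩
    rw [map_mul] at hy
    exact ⟨h y (left_ne_zero_of_mul hy), h' y (right_ne_zero_of_mul hy)⟩

theorem fbpGen_elem (f : Fin n → L) (hf : AlgebraicIndependent ℝ f)
    (k : IntermediateField.adjoin ℝ (Set.range f)) :
    ∀ᶠ y in fbpGen n, (k : L) ∈ Set.range (fbpA f y) := by
  obtain ⟨a, b, hab⟩ := (IntermediateField.mem_adjoin_range_iff ℝ f k).mp k.2
  by_cases hb : b = 0
  · subst hb
    refine Filter.Eventually.of_forall fun y => ⟨0, ?_⟩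
    rw [hab]; simp
  · have hb' : MvPolynomial.aeval f b ≠ 0 := by
      intro h
      exact hb (hf (by rw [h, map_zero]))
    refine ⟨b, hb, fun y hy => ?_⟩
    refine ⟨⟨(k, MvPolynomial.eval y a / MvPolynomial.eval y b), a, b, hy, ?_, ?_⟩, rfl⟩
    · simp only [hab]; field_simp
    · simp only; field_simp

theorem fbpGen_poly (f : Fin n → L) (hf : AlgebraicIndependent ℝ f)
    (P : Polynomial (IntermediateField.adjoin ℝ (Set.range f))) :
    ∀ᶠ y in fbpGen n, ∃ Q : Polynomial (fbpG f y),
      Q.map (fbpA f y).toRingHom = P.map (algebraMap _ L) := by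
  have : ∀ᶠ y in fbpGen n, ∀ i ∈ Finset.range (P.natDegree + 1),
      ((P.coeff i : _) : L) ∈ Set.range (fbpA f y) :=
    (Filter.eventually_all_finset _).mpr fun i _ => fbpGen_elem f hf _
  filter_upwards [this] with y hy
  have := (Polynomial.lifts_iff_coeff_lifts (f := (fbpA f y).toRingHom) (P.map (algebraMap _ L))).mpr ?_
  · exact (Polynomial.mem_lifts _).mp this
  · intro i
    rw [Polynomial.coeff_map]
    by_cases hi : i ∈ Finset.range (P.natDegree + 1)
    · exact hy i hi
    · rw [Polynomial.coeff_eq_zero_of_natDegree_lt (by simpa using hi)]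
      exact ⟨0, by simp⟩

theorem fbpGen_mvpoly (f : Fin n → L) (hf : AlgebraicIndependent ℝ f)
    (P : MvPolynomial (Fin n) (IntermediateField.adjoin ℝ (Set.range f))) :
    ∀ᶠ y in fbpGen n, ∃ Q : MvPolynomial (Fin n) (fbpG f y),
      MvPolynomial.map (fbpA f y).toRingHom Q = MvPolynomial.map (algebraMap _ L) P := by
  induction P using MvPolynomial.induction_on with
  | C r =>
    filter_upwards [fbpGen_elem f hf r] with y hy
    obtain ⟨g, hg⟩ := hy
    refine ⟨MvPolynomial.C g, ?_⟩
    rw [MvPolynomial.map_C, MvPolynomial.map_C]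
    exact congrArg _ hg
  | add p q hp hq =>
    filter_upwards [hp, hq] with y hp hq
    obtain ⟨p', hp⟩ := hp
    obtain ⟨q', hq⟩ := hq
    exact ⟨p' + q', by rw [map_add, map_add, hp, hq]⟩
  | mul_X p i hp =>
    filter_upwards [hp] with y hp
    obtain ⟨p', hp⟩ := hp
    exact ⟨p' * MvPolynomial.X i, by rw [map_mul, map_mul, hp, MvPolynomial.map_X, MvPolynomial.map_X]⟩

end fbp

theorem fbp_point {n : ℕ} {L : Type} [Field L] [Algebra ℝ L] (F : (Fin n → ℝ) → (Fin n → ℝ))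
    (f ξ : Fin n → L) (hf : AlgebraicIndependent ℝ f) (hξ : AlgebraicIndependent ℝ ξ)
    (p q : Fin n → MvPolynomial (Fin n) ℝ)
    (hq : ∀ i x, MvPolynomial.eval x (q i) ≠ 0)
    (hF : ∀ i x, F x i = MvPolynomial.eval x (p i) / MvPolynomial.eval x (q i))
    (hfp : ∀ i, f i = MvPolynomial.aeval ξ (p i) / MvPolynomial.aeval ξ (q i))
    (y : Fin n → ℝ) (θ : L) (P : Polynomial (fbpG f y)) (R : Fin n → Polynomial (fbpG f y))
    (T : MvPolynomial (Fin n) (fbpG f y))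
    (ha : P.eval₂ (fbpA f y).toRingHom θ = 0)
    (hb : ∀ j, (R j).eval₂ (fbpA f y).toRingHom θ = ξ j)
    (ht : T.eval₂ (fbpA f y).toRingHom ξ = θ)
    (hc : ∀ i, P ∣ MvPolynomial.aeval R (p i) -
      Polynomial.C ⟨(f i, y i), fbpG_mem_gen f y i⟩ * MvPolynomial.aeval R (q i))
    (hd : P ∣ T.eval₂ Polynomial.C R - Polynomial.X)
    (hP : P.map (fbpB f y).toRingHom ≠ 0) :
    (F ⁻¹' {y}).Finite ∧
      (F ⁻¹' {y}).ncard = (P.map (fbpB f y).toRingHom).roots.toFinset.card := by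
  set β := (fbpB f y).toRingHom with hβ
  set Z : Set ℝ := ↑((P.map β).roots.toFinset) with hZ
  have hZmem : ∀ t, t ∈ Z ↔ P.eval₂ β t = 0 := by
    intro t
    simp [hZ, hP, Polynomial.eval_map]
  let u : (Fin n → ℝ) → ℝ := fun x => T.eval₂ β x
  let v : ℝ → (Fin n → ℝ) := fun t j => (R j).eval₂ β t
  -- from fibre to roots
  have key1 : ∀ x, F x = y → P.eval₂ β (u x) = 0 ∧ v (u x) = x := by
    intro x hx
    have hle : fbpG f y ≤ fbpG ξ x := by
      apply fbpG_le f ξ y x hf hξ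
      intro i
      have hev : ∀ a : MvPolynomial (Fin n) ℝ,
          (MvPolynomial.aeval ξ a, MvPolynomial.eval x a) ∈ fbpG ξ x :=
        fun a => ⟨a, 1, by simp, by simp, by simp⟩
      rw [← hx, hF, hfp]
      exact fbpG_mem_div ξ x _ _ _ _ hξ (hev _) (hev _) (hq i x)
    let ι := Subalgebra.inclusion hle
    have hA : (fbpA ξ x).toRingHom.comp ι.toRingHom = (fbpA f y).toRingHom := rfl
    have hB : (fbpB ξ x).toRingHom.comp ι.toRingHom = β := rfl
    let τ : fbpG ξ x := T.eval₂ ι.toRingHom (fun i => ⟨(ξ i, x i), fbpG_mem_gen ξ x i⟩)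
    have hτA : (fbpA ξ x).toRingHom τ = θ := by
      rw [← ht, ← hA]
      exact MvPolynomial.eval₂_comp_left _ _ _ _
    have hτB : (fbpB ξ x).toRingHom τ = u x := by
      change _ = T.eval₂ β x
      rw [← hB]
      exact MvPolynomial.eval₂_comp_left _ _ _ _
    constructor
    · have h0 : P.eval₂ ι.toRingHom τ = 0 := by
        apply fbpA_inj ξ hξ x
        rw [map_zero]
        refine Eq.trans (Polynomial.hom_eval₂ _ _ (fbpA ξ x).toRingHom _) ?_
        rw [hA, hτA, ha]
      have := congrArg (fbpB ξ x).toRingHom h0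
      rwa [Polynomial.hom_eval₂, hB, hτB, map_zero] at this
    · funext j
      have h0 : (R j).eval₂ ι.toRingHom τ = ⟨(ξ j, x j), fbpG_mem_gen ξ x j⟩ := by
        apply fbpA_inj ξ hξ x
        refine Eq.trans (Polynomial.hom_eval₂ _ _ (fbpA ξ x).toRingHom _) ?_
        rw [hA, hτA, hb]
        rfl
      have := congrArg (fbpB ξ x).toRingHom h0
      rw [Polynomial.hom_eval₂, hB, hτB] at this
      exact this
  -- from roots to fibre
  have key2 : ∀ t, P.eval₂ β t = 0 → F (v t) = y ∧ u (v t) = t := by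
    intro t ht
    have hdvd : ∀ W, P ∣ W → W.eval₂ β t = 0 := by
      rintro _ ⟨W, rfl⟩
      rw [Polynomial.eval₂_mul, ht, zero_mul]
    have hae : ∀ a : MvPolynomial (Fin n) ℝ,
        (MvPolynomial.aeval R a).eval₂ β t = MvPolynomial.eval (v t) a := by
      intro a
      induction a using MvPolynomial.induction_on with
      | C r =>
        rw [MvPolynomial.aeval_C, MvPolynomial.eval_C, Polynomial.algebraMap_apply,
          Polynomial.eval₂_C]
        exact (fbpB f y).commutes r
      | add p q hp hq => rw [map_add, Polynomial.eval₂_add, hp, hq, map_add]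
      | mul_X p i hp =>
        rw [map_mul, Polynomial.eval₂_mul, hp, map_mul, MvPolynomial.aeval_X, MvPolynomial.eval_X]
    constructor
    · funext i
      have := hdvd _ (hc i)
      rw [Polynomial.eval₂_sub, Polynomial.eval₂_mul, Polynomial.eval₂_C, hae, hae] at this
      have h2 : β ⟨(f i, y i), fbpG_mem_gen f y i⟩ = y i := rfl
      rw [h2] at this
      rw [hF, div_eq_iff (hq _ _)]
      linarith
    · have := hdvd _ hd
      rw [Polynomial.eval₂_sub, Polynomial.eval₂_X, sub_eq_zero] at this
      refine Eq.trans ?_ this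
      change T.eval₂ β (v t) = _
      have h3 := MvPolynomial.eval₂_comp_left (Polynomial.eval₂RingHom β t) Polynomial.C R T
      have h4 : (Polynomial.eval₂RingHom β t).comp Polynomial.C = β := by
        ext z; simp
      rw [h4] at h3
      exact h3.symm
  have hbij : Set.BijOn u (F ⁻¹' {y}) Z := by
    refine ⟨fun x hx => (hZmem _).2 (key1 x hx).1, ?_, ?_⟩
    · intro a ha b hb hab
      rw [← (key1 a ha).2, ← (key1 b hb).2, hab]
    · intro t ht
      exact ⟨v t, (key2 t ((hZmem t).1 ht)).1, (key2 t ((hZmem t).1 ht)).2⟩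
  have hfin : (F ⁻¹' {y}).Finite :=
    Set.Finite.of_finite_image (hbij.image_eq ▸ Finset.finite_toSet _) hbij.injOn
  refine ⟨hfin, ?_⟩
  rw [← Set.ncard_coe_finset, ← hZ, ← hbij.image_eq, hbij.injOn.ncard_image]

theorem fbp_generic {n : ℕ} {L : Type} [Field L] [Algebra ℝ L] (F : (Fin n → ℝ) → (Fin n → ℝ))
    (f ξ : Fin n → L) (hf : AlgebraicIndependent ℝ f) (hξ : AlgebraicIndependent ℝ ξ)
    (p q : Fin n → MvPolynomial (Fin n) ℝ)
    (hq : ∀ i x, MvPolynomial.eval x (q i) ≠ 0)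
    (hF : ∀ i x, F x i = MvPolynomial.eval x (p i) / MvPolynomial.eval x (q i))
    (hfp : ∀ i, f i = MvPolynomial.aeval ξ (p i) / MvPolynomial.aeval ξ (q i))
    [FiniteDimensional (IntermediateField.adjoin ℝ (Set.range f)) L]
    (hgen : Algebra.adjoin (IntermediateField.adjoin ℝ (Set.range f)) (Set.range ξ) = ⊤) :
    ∀ᶠ y in fbpGen n, (F ⁻¹' {y}).Finite ∧
      ∃ k, Module.finrank (IntermediateField.adjoin ℝ (Set.range f)) L =
        (F ⁻¹' {y}).ncard + 2 * k := by
  set K := IntermediateField.adjoin ℝ (Set.range f) with hK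
  have : CharZero K := algebraRat.charZero K
  obtain ⟨θ, hθ⟩ := Field.exists_primitive_element K L
  have hint : IsIntegral K θ := IsIntegral.of_finite K θ
  have hdeg : (minpoly K θ).natDegree = Module.finrank K L :=
    (Field.primitive_element_iff_minpoly_natDegree_eq K θ).mp hθ
  have hR : ∀ j, ∃ R : Polynomial K, Polynomial.aeval θ R = ξ j := by
    intro j
    have h1 : ξ j ∈ (IntermediateField.adjoin K {θ}).toSubalgebra := by
      rw [hθ]; trivial
    rw [IntermediateField.adjoin_simple_toSubalgebra_of_isAlgebraic hint.isAlgebraic,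
      Algebra.adjoin_singleton_eq_range_aeval] at h1
    exact h1
  choose R hR using hR
  obtain ⟨T, hT⟩ : ∃ T : MvPolynomial (Fin n) K, MvPolynomial.aeval ξ T = θ := by
    have h1 : θ ∈ Algebra.adjoin K (Set.range ξ) := by rw [hgen]; trivial
    rw [Algebra.adjoin_range_eq_range_aeval] at h1
    exact h1
  have hfK : ∀ i, f i ∈ K := fun i => IntermediateField.subset_adjoin _ _ ⟨i, rfl⟩
  have hqn : ∀ i, MvPolynomial.aeval ξ (q i) ≠ 0 := by
    intro i h
    have : q i = 0 := hξ (by rw [h, map_zero])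
    exact hq i 0 (by rw [this, map_zero])
  have hcomp : ∀ a : MvPolynomial (Fin n) ℝ,
      Polynomial.aeval θ (MvPolynomial.aeval R a) = MvPolynomial.aeval ξ a := by
    intro a
    induction a using MvPolynomial.induction_on with
    | C r =>
      rw [MvPolynomial.aeval_C, MvPolynomial.aeval_C, Polynomial.algebraMap_apply,
        Polynomial.aeval_C, ← IsScalarTower.algebraMap_apply]
    | add p q hp hq => simp only [map_add, hp, hq]
    | mul_X p i hp => simp only [map_mul, hp, MvPolynomial.aeval_X, hR]
  have hc : ∀ i, ∃ Q, MvPolynomial.aeval R (p i) -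
      Polynomial.C (⟨f i, hfK i⟩ : K) * MvPolynomial.aeval R (q i) = minpoly K θ * Q := by
    intro i
    apply minpoly.dvd
    rw [map_sub, map_mul, Polynomial.aeval_C, hcomp, hcomp]
    change _ - f i * _ = 0
    rw [hfp, div_mul_cancel₀ _ (hqn i), sub_self]
  choose Q hQ using hc
  obtain ⟨S, hS⟩ : ∃ S, MvPolynomial.aeval R T - Polynomial.X = minpoly K θ * S := by
    apply minpoly.dvd
    rw [map_sub, Polynomial.aeval_X, sub_eq_zero]
    refine Eq.trans ?_ hT
    rw [MvPolynomial.comp_aeval_apply]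
    simp only [hR]
  obtain ⟨a, b, hab⟩ : IsCoprime (minpoly K θ) (Polynomial.derivative (minpoly K θ)) :=
    (Algebra.IsSeparable.isSeparable K θ)
  filter_upwards [fbpGen_poly f hf (minpoly K θ), Filter.eventually_all.2 fun i => fbpGen_poly f hf (R i),
    Filter.eventually_all.2 fun i => fbpGen_poly f hf (Q i), fbpGen_poly f hf S, fbpGen_poly f hf a,
    fbpGen_poly f hf b, fbpGen_mvpoly f hf T] with y hP' hR' hQ' hS' ha' hb' hT'
  obtain ⟨P', hP'⟩ := hP'
  choose R' hR' using hR'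
  choose Q' hQ' using hQ'
  obtain ⟨S', hS'⟩ := hS'
  obtain ⟨a', ha'⟩ := ha'
  obtain ⟨b', hb'⟩ := hb'
  obtain ⟨T', hT'⟩ := hT'
  set α := (fbpA f y).toRingHom with hα
  set β := (fbpB f y).toRingHom with hβ
  have hαinj : Function.Injective α := fbpA_inj f hf y
  have hmapinj := Polynomial.map_injective α hαinj
  have hmonic : P'.Monic := by
    apply Polynomial.monic_of_injective hαinj
    rw [hP']
    exact (minpoly.monic hint).map _
  have hdegP : P'.natDegree = Module.finrank K L := by
    rw [← Polynomial.natDegree_map_eq_of_injective hαinj, hP', Polynomial.natDegree_map, hdeg]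
  have hsep : (P'.map β).Separable := by
    refine Polynomial.Separable.map (f := β) ⟨a', b', hmapinj ?_⟩
    have := congrArg (Polynomial.map (algebraMap K L)) hab
    simp only [Polynomial.map_add, Polynomial.map_mul, Polynomial.map_one,
      ← Polynomial.derivative_map] at this ⊢
    rw [ha', hb', hP', this]
  have hmv : ∀ c : MvPolynomial (Fin n) ℝ, (MvPolynomial.aeval R' c).map α =
      (MvPolynomial.aeval R c).map (algebraMap K L) := by
    intro c
    induction c using MvPolynomial.induction_on with
    | C r =>
      rw [MvPolynomial.aeval_C, MvPolynomial.aeval_C, Polynomial.algebraMap_apply,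
        Polynomial.algebraMap_apply, Polynomial.map_C, Polynomial.map_C]
      refine congrArg _ ?_
      exact ((fbpA f y).commutes r).trans (IsScalarTower.algebraMap_apply ℝ K L r)
    | add p q hp hq => simp only [map_add, Polynomial.map_add, hp, hq]
    | mul_X p i hp => 
      simp only [map_mul, Polynomial.map_mul, hp, MvPolynomial.aeval_X, hR']
      rfl
  have hmain := fbp_point F f ξ hf hξ p q hq hF hfp y θ P' R' T' ?_ ?_ ?_ ?_ ?_ ?_
  · refine ⟨hmain.1, ?_⟩
    obtain ⟨k, hk⟩ := fbp_parity (P'.map β) (hmonic.map β).ne_zero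
    refine ⟨k, ?_⟩
    rw [hmain.2, Multiset.toFinset_card_of_nodup (Polynomial.nodup_roots hsep), ← hk,
      hmonic.natDegree_map, hdegP]
  · rw [← Polynomial.eval_map, hP', Polynomial.eval_map, ← Polynomial.aeval_def, minpoly.aeval]
  · intro j
    rw [← Polynomial.eval_map, hR', Polynomial.eval_map, ← Polynomial.aeval_def, hR]
  · rw [← MvPolynomial.eval_map, hT', MvPolynomial.eval_map, ← MvPolynomial.aeval_def, hT]
  · intro i
    refine ⟨Q' i, hmapinj ?_⟩
    have := congrArg (Polynomial.map (algebraMap K L)) (hQ i)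
    simp only [Polynomial.map_sub, Polynomial.map_mul, Polynomial.map_C] at this ⊢
    rw [hmv, hmv, hP', hQ', ← this]
    rfl
  · refine ⟨S', hmapinj ?_⟩
    have := congrArg (Polynomial.map (algebraMap K L)) hS
    simp only [Polynomial.map_sub, Polynomial.map_mul, Polynomial.map_X] at this ⊢
    rw [hP', hS', ← this]
    congr 1
    have h1 := MvPolynomial.eval₂_comp_left (Polynomial.mapRingHom α) Polynomial.C R' T'
    have h2 := MvPolynomial.eval₂_comp_left (Polynomial.mapRingHom (algebraMap K L)) Polynomial.C R T
    rw [Polynomial.mapRingHom_comp_C, ← MvPolynomial.eval₂_map] at h1 h2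
    rw [hT'] at h1
    have h3 : (Polynomial.mapRingHom α : _ → _) ∘ R' = (Polynomial.mapRingHom (algebraMap K L)) ∘ R := by
      funext i; exact hR' i
    rw [h3, ← h2] at h1
    exact h1
  · exact (hmonic.map β).ne_zero

theorem fbp_algInd {n : ℕ} {L : Type} [Field L] [Algebra ℝ L] (F : (Fin n → ℝ) → (Fin n → ℝ))
    (f ξ : Fin n → L) (hξ : AlgebraicIndependent ℝ ξ)
    (p q : Fin n → MvPolynomial (Fin n) ℝ)
    (hq : ∀ i x, MvPolynomial.eval x (q i) ≠ 0)
    (hF : ∀ i x, F x i = MvPolynomial.eval x (p i) / MvPolynomial.eval x (q i))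
    (hfp : ∀ i, f i = MvPolynomial.aeval ξ (p i) / MvPolynomial.aeval ξ (q i))
    (hmap : ∀ x, Filter.map F (nhds x) = nhds (F x)) : AlgebraicIndependent ℝ f := by
  rw [algebraicIndependent_iff]
  intro h h0
  by_contra hne
  have key : ∀ a : MvPolynomial (Fin n) ℝ, ∀ x,
      (MvPolynomial.aeval f a, MvPolynomial.eval (F x) a) ∈ fbpG ξ x := by
    intro a x
    induction a using MvPolynomial.induction_on with
    | C r => simpa using (fbpG ξ x).algebraMap_mem r
    | add p q hp hq => simpa using (fbpG ξ x).add_mem hp hq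
    | mul_X p i hp =>
      have hev : ∀ a : MvPolynomial (Fin n) ℝ,
          (MvPolynomial.aeval ξ a, MvPolynomial.eval x a) ∈ fbpG ξ x :=
        fun a => ⟨a, 1, by simp, by simp, by simp⟩
      have h1 : (f i, F x i) ∈ fbpG ξ x := by
        rw [hF, hfp]
        exact fbpG_mem_div ξ x _ _ _ _ hξ (hev _) (hev _) (hq i x)
      simpa using (fbpG ξ x).mul_mem hp h1
  have hz : ∀ x, MvPolynomial.eval (F x) h = 0 := by
    intro x
    have h1 := key h x
    rw [h0] at h1
    have h2 : (⟨_, h1⟩ : fbpG ξ x) = 0 := by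
      apply fbpA_inj ξ hξ x
      rw [map_zero]; rfl
    exact congrArg (fbpB ξ x) h2
  obtain ⟨z, ⟨x, rfl⟩, hz'⟩ := fbp_exists_generic h hne (F 0) (Set.range F)
    (by rw [← hmap 0]; exact Filter.range_mem_map)
  exact hz' (hz x)

theorem fbp_fd {n : ℕ} {L : Type} [Field L] [Algebra ℝ L] [Algebra (MvPolynomial (Fin n) ℝ) L]
    [IsScalarTower ℝ (MvPolynomial (Fin n) ℝ) L] [IsFractionRing (MvPolynomial (Fin n) ℝ) L]
    (f : Fin n → L) (hf : AlgebraicIndependent ℝ f) :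
    FiniteDimensional (IntermediateField.adjoin ℝ (Set.range f)) L ∧
    Algebra.adjoin (IntermediateField.adjoin ℝ (Set.range f)) (Set.range fun i : Fin n =>
      algebraMap (MvPolynomial (Fin n) ℝ) L (MvPolynomial.X i)) = ⊤ := by
  set K := IntermediateField.adjoin ℝ (Set.range f) with hK
  set ξ : Fin n → L := fun i => algebraMap (MvPolynomial (Fin n) ℝ) L (MvPolynomial.X i) with hξ
  have hae : ∀ a : MvPolynomial (Fin n) ℝ, MvPolynomial.aeval ξ a = algebraMap _ L a := by
    intro a
    have := MvPolynomial.aeval_algebraMap_apply L (MvPolynomial.X : Fin n → MvPolynomial (Fin n) ℝ) a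
    rw [MvPolynomial.aeval_X_left_apply] at this
    exact this
  have htop : IntermediateField.adjoin ℝ (Set.range ξ) = ⊤ := by
    rw [eq_top_iff]
    intro z _
    rw [IntermediateField.mem_adjoin_range_iff]
    obtain ⟨a, b, -, h⟩ := IsFractionRing.div_surjective (A := MvPolynomial (Fin n) ℝ) z
    exact ⟨a, b, by rw [hae, hae, h]⟩
  have hξi : AlgebraicIndependent ℝ ξ := by
    intro a b hab
    rw [hae, hae] at hab
    exact IsFractionRing.injective (MvPolynomial (Fin n) ℝ) L hab
  have hBL : Algebra.IsAlgebraic (MvPolynomial (Fin n) ℝ) L := 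
    (IsFractionRing.comap_isAlgebraic_iff (A := MvPolynomial (Fin n) ℝ) (K := L) (C := L)).mpr
      inferInstance
  have htb : IsTranscendenceBasis ℝ ξ :=
    (IsTranscendenceBasis.mvPolynomial (Fin n) ℝ).algebraMap_comp (A := L)
  have hcard := htb.lift_cardinalMk_eq_trdeg
  have hfb : IsTranscendenceBasis ℝ f := hf.isTranscendenceBasis_of_lift_trdeg_le_of_finite hcard.ge
  have halg : Algebra.IsAlgebraic K L := hfb.isAlgebraic_field
  have htop' : IntermediateField.adjoin K (Set.range ξ) = ⊤ := by
    rw [eq_top_iff]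
    intro z _
    have hz : z ∈ IntermediateField.adjoin ℝ (Set.range ξ) := by rw [htop]; trivial
    have : IntermediateField.adjoin ℝ (Set.range ξ) ≤
        (IntermediateField.adjoin K (Set.range ξ)).restrictScalars ℝ :=
      IntermediateField.adjoin_le_iff.mpr (IntermediateField.subset_adjoin K _)
    exact this hz
  constructor
  · have := IntermediateField.finiteDimensional_adjoin (K := K) (S := Set.range ξ)
      (fun x _ => (Algebra.IsAlgebraic.isAlgebraic (R := K) x).isIntegral)
    rw [htop'] at this
    exact IntermediateField.topEquiv.toLinearEquiv.finiteDimensional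
  · rw [← IntermediateField.adjoin_toSubalgebra_of_isAlgebraic
      (fun x _ => Algebra.IsAlgebraic.isAlgebraic (R := K) x), htop']
    rfl

/-- Let `F : ℝⁿ → ℝⁿ` be an everywhere defined real rational map with nowhere
vanishing Jacobian determinant and let `d` be the degree of `ℝ(F) ⊆ ℝ(x₁, …, xₙ)`. Then
every fiber of `F` is finite with at most `d` points, the maximum `N` of the fiber
cardinalities is attained and satisfies `1 ≤ N ≤ d`, `d − N` is even, and if `F` is
injective then `d` is odd. -/
theorem fiber_bounds_and_parity
    (n : ℕ) (F : (Fin n → ℝ) → (Fin n → ℝ))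
    (f : Fin n → FractionRing (MvPolynomial (Fin n) ℝ))
    (hF : IsEverywhereDefRatMap n F f)
    (hjac : ∀ x : Fin n → ℝ, (fderiv ℝ F x).det ≠ 0)
    (d : ℕ)
    (hd : d = Module.finrank (IntermediateField.adjoin ℝ (Set.range f))
      (FractionRing (MvPolynomial (Fin n) ℝ))) :
    (∀ y : Fin n → ℝ, (F ⁻¹' {y}).Finite ∧ (F ⁻¹' {y}).ncard ≤ d) ∧
    ∃ N : ℕ, 1 ≤ N ∧ N ≤ d ∧
      (∃ y : Fin n → ℝ, (F ⁻¹' {y}).ncard = N) ∧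
      (∀ y : Fin n → ℝ, (F ⁻¹' {y}).ncard ≤ N) ∧
      Even (d - N) ∧
      (Function.Injective F → Odd d) := by
  choose p q hq hfp hF using hF
  have hmap := fbp_map_nhds F (fbp_contDiff F p q hq hF) hjac
  set ξ : Fin n → FractionRing (MvPolynomial (Fin n) ℝ) := fun i =>
    algebraMap (MvPolynomial (Fin n) ℝ) (FractionRing (MvPolynomial (Fin n) ℝ))
        (MvPolynomial.X i) with hξ
  have hae : ∀ a : MvPolynomial (Fin n) ℝ, MvPolynomial.aeval ξ a =
      algebraMap _ (FractionRing (MvPolynomial (Fin n) ℝ)) a := by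
    intro a
    have := MvPolynomial.aeval_algebraMap_apply (FractionRing (MvPolynomial (Fin n) ℝ))
      (MvPolynomial.X : Fin n → MvPolynomial (Fin n) ℝ) a
    rw [MvPolynomial.aeval_X_left_apply] at this
    exact this
  have hξi : AlgebraicIndependent ℝ ξ := by
    intro a b hab
    rw [hae, hae] at hab
    exact IsFractionRing.injective (MvPolynomial (Fin n) ℝ) _ hab
  simp only [← hae] at hfp
  have hf := fbp_algInd F f ξ hξi p q hq hF hfp hmap
  obtain ⟨hfd, hgen⟩ := fbp_fd f hf
  obtain ⟨g, hg0, hg⟩ := fbp_generic F f ξ hf hξi p q hq hF hfp hgen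
  rw [← hd] at hg
  have hup : ∀ y (s : Finset (Fin n → ℝ)), (∀ x ∈ s, F x = y) → s.card ≤ d := by
    intro y s hs
    obtain ⟨V, hV, h⟩ := fbp_lower F hmap y s hs
    obtain ⟨z, hzV, hz⟩ := fbp_exists_generic g hg0 y V hV
    obtain ⟨hfin, k, hk⟩ := hg z hz
    have := h z hzV hfin
    omega
  have hfin : ∀ y, (F ⁻¹' {y}).Finite := by
    intro y
    by_contra hinf
    obtain ⟨s, hs, hc⟩ := Set.Infinite.exists_subset_card_eq hinf (d + 1)
    have := hup y s (fun x hx => hs hx)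
    omega
  have hle : ∀ y, (F ⁻¹' {y}).ncard ≤ d := by
    intro y
    rw [Set.ncard_eq_toFinset_card _ (hfin y)]
    exact hup y _ (fun x hx => by simpa using hx)
  refine ⟨fun y => ⟨hfin y, hle y⟩, ?_⟩
  have hbdd : BddAbove (Set.range fun y => (F ⁻¹' {y}).ncard) :=
    ⟨d, by rintro _ ⟨y, rfl⟩; exact hle y⟩
  obtain ⟨y₀, hy₀⟩ := Nat.sSup_mem (Set.range_nonempty fun y => (F ⁻¹' {y}).ncard) hbdd
  have hmax : ∀ y, (F ⁻¹' {y}).ncard ≤ (F ⁻¹' {y₀}).ncard := by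
    intro y
    have := le_csSup hbdd ⟨y, rfl⟩
    rw [← hy₀] at this
    exact this
  have h1 : 1 ≤ (F ⁻¹' {y₀}).ncard := by
    refine le_trans ?_ (hmax (F 0))
    exact (Set.ncard_pos (hfin _)).mpr ⟨0, rfl⟩
  have hpar : ∃ k, d = (F ⁻¹' {y₀}).ncard + 2 * k := by
    obtain ⟨V, hV, h⟩ := fbp_lower F hmap y₀ (hfin y₀).toFinset (fun x hx => by simpa using hx)
    obtain ⟨z, hzV, hz⟩ := fbp_exists_generic g hg0 y₀ V hV
    obtain ⟨-, k, hk⟩ := hg z hz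
    have h2 := h z hzV (hfin z)
    rw [← Set.ncard_eq_toFinset_card _ (hfin y₀)] at h2
    have h3 := hmax z
    exact ⟨k, by omega⟩
  obtain ⟨k, hk⟩ := hpar
  refine ⟨_, h1, hle y₀, ⟨y₀, rfl⟩, hmax, ⟨k, by omega⟩, fun hinj => ?_⟩
  have : (F ⁻¹' {y₀}).ncard ≤ 1 := by
    rw [Set.ncard_le_one (hfin y₀)]
    intro a ha b hb
    exact hinj (Eq.trans ha hb.symm)
  exact ⟨k, by omega⟩
end

section
/- Let F : ℝ^n → ℝ^n be an everywhere defined real rational map whose Jacobian determinant is not identically zero on ℝ^n, so that the field extension ℝ(F) ⊆ ℝ(x_1, …, x_n) is algebraic of finite degree. If this degree is odd, then the image F(ℝ^n) is dense in ℝ^n. -/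
open Polynomial in
theorem aux_odd_root (f : ℝ[X]) (hm : f.Monic) (ho : Odd f.natDegree) : ∃ t, f.eval t = 0 := by
  have h1 : Filter.Tendsto (fun x => f.eval x) Filter.atTop Filter.atTop := by
    apply f.tendsto_atTop_of_leadingCoeff_nonneg
    · rw [← natDegree_pos_iff_degree_pos]; exact ho.pos
    · rw [hm.leadingCoeff]; exact zero_le_one
  have h2 : Filter.Tendsto (fun x => (-(f.comp (-X))).eval x) Filter.atTop Filter.atTop := by
    apply tendsto_atTop_of_leadingCoeff_nonneg
    · rw [← natDegree_pos_iff_degree_pos, natDegree_neg, natDegree_comp, natDegree_neg,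
        natDegree_X, mul_one]; exact ho.pos
    · rw [leadingCoeff_neg, leadingCoeff_comp (by simp), hm.leadingCoeff]
      simp [ho.neg_one_pow]
  obtain ⟨a, ha⟩ := (h1.eventually_ge_atTop 0).exists
  obtain ⟨b, hb⟩ := (h2.eventually_ge_atTop 0).exists
  have hb' : f.eval (-b) ≤ 0 := by simpa using hb
  obtain ⟨t, ht⟩ := mem_range_of_exists_le_of_exists_ge f.continuous ⟨_, hb'⟩ ⟨_, ha⟩
  exact ⟨t, ht⟩

theorem aux_dense (n : ℕ) (s : MvPolynomial (Fin n) ℝ) (hs : s ≠ 0) :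
    Dense {y : Fin n → ℝ | MvPolynomial.eval y s ≠ 0} := by
  rw [Metric.dense_iff]
  intro x r hr
  by_contra hcon
  apply hs
  apply MvPolynomial.funext_set (fun i => Metric.ball (x i) r)
  · intro i
    exact infinite_of_mem_nhds (x i) (Metric.ball_mem_nhds _ hr)
  · intro y hy
    by_contra h
    refine hcon ⟨y, ?_, by simpa using h⟩
    rw [ball_pi _ hr]
    exact hy

theorem aux_algInd (n : ℕ) (f : Fin n → FractionRing (MvPolynomial (Fin n) ℝ))
    (hfin : FiniteDimensional (IntermediateField.adjoin ℝ (Set.range f))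
      (FractionRing (MvPolynomial (Fin n) ℝ))) : AlgebraicIndependent ℝ f := by
  have h0 : Algebra.IsAlgebraic (Algebra.adjoin ℝ (Set.range f))
      (FractionRing (MvPolynomial (Fin n) ℝ)) := by
    open IntermediateField.algebraAdjoinAdjoin in
    rw [IsFractionRing.comap_isAlgebraic_iff (K := IntermediateField.adjoin ℝ (Set.range f))]
    infer_instance
  refine (Algebra.IsAlgebraic.isTranscendenceBasis_of_le_trdeg_of_finite ℝ f ?_).1
  have : AlgebraicIndependent ℝ (fun i : Fin n => algebraMap (MvPolynomial (Fin n) ℝ)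
      (FractionRing (MvPolynomial (Fin n) ℝ)) (MvPolynomial.X i)) := by
    exact (MvPolynomial.algebraicIndependent_X (Fin n) ℝ).map' 
      (f := IsScalarTower.toAlgHom ℝ (MvPolynomial (Fin n) ℝ)
      (FractionRing (MvPolynomial (Fin n) ℝ))) (IsFractionRing.injective _ _)
  exact this.cardinalMk_le_trdeg

theorem aux_denom {A K : Type*} [CommRing A] [IsDomain A] [Field K] (φ : A →+* K)
    (hφ : Function.Injective φ) (h : ∀ x : K, ∃ a b : A, x = φ a / φ b) (E : Finset K) :
    ∃ s : A, s ≠ 0 ∧ ∀ e ∈ E, ∃ a, e * φ s = φ a := by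
  classical
  induction E using Finset.induction_on with
  | empty => exact ⟨1, one_ne_zero, by simp⟩
  | insert e E he ih =>
    obtain ⟨s, hs, ih⟩ := ih
    have h1 : ∃ a b : A, b ≠ 0 ∧ e * φ b = φ a := by
      obtain ⟨a, b, hab⟩ := h e
      by_cases hb : b = 0
      · exact ⟨0, 1, one_ne_zero, by simp [hab, hb]⟩
      · refine ⟨a, b, hb, ?_⟩
        rw [hab, div_mul_cancel₀]
        rwa [map_ne_zero_iff _ hφ]
    obtain ⟨a, b, hb, hab⟩ := h1
    refine ⟨s * b, mul_ne_zero hs hb, ?_⟩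
    intro e' he'
    rcases Finset.mem_insert.1 he' with rfl | he'
    · exact ⟨s * a, by rw [map_mul, map_mul, ← hab]; ring⟩
    · obtain ⟨c, hc⟩ := ih e' he'
      exact ⟨c * b, by rw [map_mul, map_mul, ← hc]; ring⟩

open Polynomial in
theorem aux_core {ι R K L : Type*} [CommRing R] [Algebra ℝ R] [Field K] [Algebra ℝ K]
    [Field L] [Algebra ℝ L] [Algebra K L] [IsScalarTower ℝ K L]
    (j : R →ₐ[ℝ] K) (hj : Function.Injective j) (α : L)
    (m : R[X]) (hm : m.Monic) (hmm : m.map (j : R →+* K) = minpoly K α) (hodd : Odd m.natDegree)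
    (X : ι → L) (g : ι → R[X]) (hg : ∀ i, aeval α ((g i).map (j : R →+* K)) = X i)
    (ψ : R →ₐ[ℝ] ℝ) :
    ∃ x : ι → ℝ, ∀ (p q : MvPolynomial ι ℝ) (r : R),
      algebraMap K L (j r) * MvPolynomial.aeval X q = MvPolynomial.aeval X p →
      ψ r * MvPolynomial.eval x q = MvPolynomial.eval x p := by
  obtain ⟨t, ht⟩ := aux_odd_root (m.map (ψ : R →+* ℝ)) (hm.map _)
    (by rwa [hm.natDegree_map])
  -- evaluation homs
  let e1 : R[X] →ₐ[ℝ] L := ((aeval α : K[X] →ₐ[K] L).restrictScalars ℝ).comp (mapAlgHom j)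
  let e2 : R[X] →ₐ[ℝ] ℝ := ((aeval t : ℝ[X] →ₐ[ℝ] ℝ)).comp (mapAlgHom ψ)
  have he1 : ∀ P : R[X], e1 P = aeval α (P.map (j : R →+* K)) := by
    intro P
    rfl
  have he2 : ∀ P : R[X], e2 P = eval t (P.map (ψ : R →+* ℝ)) := by
    intro P
    rw [← coe_aeval_eq_eval]; rfl
  have key : ∀ h : R[X], e1 h = 0 → e2 h = 0 := by
    intro h hh
    have hr : h %ₘ m = 0 := by
      have hz : (h %ₘ m).map (j : R →+* K) = 0 := by
        rw [map_modByMonic _ hm, hmm]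
        rw [he1] at hh
        exact (modByMonic_eq_zero_iff_dvd (hmm ▸ hm.map _)).2 (minpoly.dvd K α hh)
      exact (Polynomial.map_eq_zero_iff (f := (j : R →+* K)) hj).1 hz
    obtain ⟨c, rfl⟩ := (modByMonic_eq_zero_iff_dvd hm).1 hr
    rw [map_mul, he2 m, ht, zero_mul]
  refine ⟨fun i => e2 (g i), fun p q r hpq => ?_⟩
  have hX : ∀ P : MvPolynomial ι ℝ, e1 (MvPolynomial.aeval g P) = MvPolynomial.aeval X P := by
    intro P
    rw [MvPolynomial.comp_aeval_apply]
    have : (fun i => e1 (g i)) = X := by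
      funext i
      rw [he1, hg]
    rw [this]
  have hx : ∀ P : MvPolynomial ι ℝ, e2 (MvPolynomial.aeval g P)
      = MvPolynomial.eval (fun i => e2 (g i)) P := by
    intro P
    rw [MvPolynomial.comp_aeval_apply]
    rfl
  have := key (C r * MvPolynomial.aeval g q - MvPolynomial.aeval g p) (by
    have hC : e1 (C r) = algebraMap K L (j r) := by rw [he1]; simp
    rw [map_sub, map_mul, hX, hX, hC, hpq, sub_self])
  have hC : e2 (C r) = ψ r := by rw [he2]; simp
  rw [map_sub, map_mul, hx, hx, hC] at this
  exact sub_eq_zero.1 this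

open Polynomial in
theorem dense_image_of_odd_degree
    (n : ℕ) (F : (Fin n → ℝ) → (Fin n → ℝ))
    (f : Fin n → FractionRing (MvPolynomial (Fin n) ℝ))
    (hF : IsEverywhereDefRatMap n F f)
    (hjac : ∃ x : Fin n → ℝ, (fderiv ℝ F x).det ≠ 0)
    (hodd : Odd (Module.finrank (IntermediateField.adjoin ℝ (Set.range f))
      (FractionRing (MvPolynomial (Fin n) ℝ)))) :
    Dense (Set.range F) := by
  classical
  have hfin : FiniteDimensional (IntermediateField.adjoin ℝ (Set.range f))
      (FractionRing (MvPolynomial (Fin n) ℝ)) := Module.finite_of_finrank_pos hodd.pos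
  have hind := aux_algInd n f hfin
  let L := FractionRing (MvPolynomial (Fin n) ℝ)
  let K := IntermediateField.adjoin ℝ (Set.range f)
  let f' : Fin n → K := fun i => ⟨f i, IntermediateField.subset_adjoin _ _ ⟨i, rfl⟩⟩
  let φ : MvPolynomial (Fin n) ℝ →ₐ[ℝ] K := MvPolynomial.aeval f'
  have hφv : ∀ a, ((φ a : K) : L) = MvPolynomial.aeval f a := fun a =>
    MvPolynomial.comp_aeval_apply f' K.val a
  have hφ : Function.Injective φ := by
    intro a b hab
    apply hind
    rw [← hφv, ← hφv, hab]
  have hfrac : ∀ x : K, ∃ a b, x = φ a / φ b := by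
    intro x
    obtain ⟨a, b, h⟩ := (IntermediateField.mem_adjoin_range_iff ℝ f (x : L)).1 x.2
    refine ⟨a, b, Subtype.ext ?_⟩
    rw [h, ← hφv, ← hφv]
    rfl
  obtain ⟨α, hα⟩ := Field.exists_primitive_element K L
  have hint : IsIntegral K α := Algebra.IsIntegral.isIntegral α
  have hg : ∀ i : Fin n, ∃ g : K[X], aeval α g = algebraMap (MvPolynomial (Fin n) ℝ) L
      (MvPolynomial.X i) := by
    intro i
    have h1 : algebraMap (MvPolynomial (Fin n) ℝ) L (MvPolynomial.X i) ∈
        IntermediateField.adjoin K {α} := by rw [hα]; trivial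
    rw [← IntermediateField.mem_toSubalgebra,
      IntermediateField.adjoin_simple_toSubalgebra_of_isAlgebraic hint.isAlgebraic,
      Algebra.adjoin_singleton_eq_range_aeval] at h1
    exact h1
  choose g hg using hg
  obtain ⟨s, hs, hsE⟩ := aux_denom (φ : MvPolynomial (Fin n) ℝ →+* K) hφ hfrac
    ((minpoly K α).coeffs ∪ Finset.univ.biUnion fun i => (g i).coeffs)
  let R := Localization.Away s
  have hunit : ∀ y : Submonoid.powers s, IsUnit (φ y) := by
    rintro ⟨_, k, rfl⟩
    refine IsUnit.mk0 _ ?_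
    rw [map_ne_zero_iff _ hφ]
    exact pow_ne_zero _ hs
  let j : R →ₐ[ℝ] K := IsLocalization.liftAlgHom (M := Submonoid.powers s) (f := φ) hunit
  have hjφ : ∀ a, j (algebraMap _ R a) = φ a := fun a => IsLocalization.lift_eq _ a
  have hj : Function.Injective j := by
    rw [injective_iff_map_eq_zero]
    intro z hz
    obtain ⟨a, b, rfl⟩ := IsLocalization.exists_mk'_eq (Submonoid.powers s) z
    have h1 : j (IsLocalization.mk' R a b) * φ b = φ a := by
      rw [← hjφ, ← map_mul, IsLocalization.mk'_spec, hjφ]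
    rw [hz, zero_mul] at h1
    have : a = 0 := hφ (by rw [← h1, map_zero])
    rw [this, IsLocalization.mk'_zero]
  have hrange : ∀ e ∈ ((minpoly K α).coeffs ∪ Finset.univ.biUnion fun i => (g i).coeffs),
      e ∈ Set.range (j : R →+* K) := by
    intro e he
    obtain ⟨a, ha⟩ := hsE e he
    refine ⟨IsLocalization.mk' R a (⟨s, Submonoid.mem_powers s⟩ : Submonoid.powers s), ?_⟩
    have hs0 : φ s ≠ 0 := by rwa [map_ne_zero_iff _ hφ]
    apply mul_right_cancel₀ hs0
    have h2 : j (IsLocalization.mk' R a (⟨s, Submonoid.mem_powers s⟩ : Submonoid.powers s))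
        * φ s = φ a := by
      rw [← hjφ s, ← map_mul]
      rw [IsLocalization.mk'_spec R a (⟨s, Submonoid.mem_powers s⟩ : Submonoid.powers s), hjφ]
    exact h2.trans ha.symm
  obtain ⟨m, hmm, hmd, hm⟩ := lifts_and_natDegree_eq_and_monic (f := (j : R →+* K))
    (p := minpoly K α) ((lifts_iff_coeffs_subset_range _).2 fun e he =>
      hrange e (Finset.mem_union_left _ he)) (minpoly.monic hint)
  have hgl : ∀ i, ∃ g' : R[X], g'.map (j : R →+* K) = g i := by
    intro i
    exact (lifts_iff_set_range _).1 ((lifts_iff_coeffs_subset_range _).2 fun e he =>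
      hrange e (Finset.mem_union_right _ (Finset.mem_biUnion.2 ⟨i, Finset.mem_univ i, he⟩)))
  choose g' hg' using hgl
  have hmo : Odd m.natDegree := by
    rw [hmd, ← (Field.primitive_element_iff_minpoly_natDegree_eq K α).1 hα] at *
    exact hodd
  refine (aux_dense n s hs).mono ?_
  intro y hy
  have hunit2 : ∀ z : Submonoid.powers s, IsUnit (MvPolynomial.aeval (R := ℝ) y
      (z : MvPolynomial (Fin n) ℝ)) := by
    rintro ⟨_, k, rfl⟩
    refine IsUnit.mk0 _ ?_
    rw [map_pow]
    exact pow_ne_zero _ hy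
  let ψ : R →ₐ[ℝ] ℝ := IsLocalization.liftAlgHom (M := Submonoid.powers s)
    (f := MvPolynomial.aeval (R := ℝ) y) hunit2
  have hψ : ∀ a, ψ (algebraMap _ R a) = MvPolynomial.aeval y a :=
    fun a => IsLocalization.lift_eq _ a
  obtain ⟨x, hx⟩ := aux_core j hj α m hm hmm hmo
    (fun i => algebraMap (MvPolynomial (Fin n) ℝ) L (MvPolynomial.X i)) g'
    (fun i => by rw [hg', hg]) ψ
  refine ⟨x, funext fun i => ?_⟩
  obtain ⟨p, q, hq, hf, hFx⟩ := hF i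
  have hX : ∀ P : MvPolynomial (Fin n) ℝ, MvPolynomial.aeval
      (fun i => algebraMap (MvPolynomial (Fin n) ℝ) L (MvPolynomial.X i)) P
      = algebraMap (MvPolynomial (Fin n) ℝ) L P := by
    intro P
    have := MvPolynomial.comp_aeval_apply (R := ℝ) (MvPolynomial.X : Fin n → MvPolynomial (Fin n) ℝ)
      (IsScalarTower.toAlgHom ℝ (MvPolynomial (Fin n) ℝ) L) P
    rw [MvPolynomial.aeval_X_left_apply] at this
    exact this.symm
  have hq0 : algebraMap (MvPolynomial (Fin n) ℝ) L q ≠ 0 := by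
    rw [map_ne_zero_iff _ (IsFractionRing.injective _ _)]
    rintro rfl
    exact hq 0 (map_zero _)
  have key := hx p q (algebraMap _ R (MvPolynomial.X i)) (by
    rw [hX, hX, hjφ]
    have : algebraMap K L (φ (MvPolynomial.X i)) = f i := by
      change ((φ (MvPolynomial.X i) : K) : L) = f i
      rw [hφv, MvPolynomial.aeval_X]
    rw [this, hf, div_mul_cancel₀ _ hq0])
  rw [hψ, MvPolynomial.aeval_X] at key
  rw [hFx, ← key, mul_div_cancel_right₀ _ (hq x)]
end

section
/- Let F : ℝ^n → ℝ^n be an everywhere defined real rational map whose Jacobian determinant is not identically zero on ℝ^n. Then there exists t ∈ ℝ(x_1, …, x_n) such that: (1) t can be written as p/q with real polynomials p, q where q vanishes nowhere on ℝ^n (t is defined everywhere on ℝ^n); (2) t is integral over the subring ℝ[f_1, …, f_n] of ℝ(x_1, …, x_n) generated by the components of F; and (3) t is a primitive element for the extension, i.e., the subfield of ℝ(x_1, …, x_n) generated by ℝ(F) and t is all of ℝ(x_1, …, x_n). -/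
open MvPolynomial in
theorem aux_hasFDerivAt_eval {n : ℕ} (p : MvPolynomial (Fin n) ℝ) (x : Fin n → ℝ) :
    HasFDerivAt (fun y : Fin n → ℝ => eval y p)
      (∑ j, (eval x (pderiv j p)) • (ContinuousLinearMap.proj j : (Fin n → ℝ) →L[ℝ] ℝ)) x := by
  classical
  induction p using MvPolynomial.induction_on with
  | C a => simpa using hasFDerivAt_const a x
  | add p q hp hq =>
    have h := hp.add hq
    simp only [map_add, add_smul, Finset.sum_add_distrib]
    exact h
  | mul_X p i hp =>
    have h := hp.mul (hasFDerivAt_apply i x)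
    simp only [map_mul, eval_X]
    refine h.congr_fderiv ?_
    ext v
    simp [pderiv_X, Pi.single_apply, Finset.sum_add_distrib, add_mul, Finset.mul_sum,
      apply_ite (eval x)]
    simp [← Finset.mul_sum, mul_comm, mul_left_comm]

open MvPolynomial in
theorem aux_derivation {n : ℕ} {K M : Type*} [Field K] [Algebra (MvPolynomial (Fin n) ℝ) K]
    [AddCommGroup M] [Module K M] (d : K → M) (hadd : ∀ a b, d (a + b) = d a + d b)
    (hmul : ∀ a b, d (a * b) = a • d b + b • d a)
    (hC : ∀ r : ℝ, d (algebraMap (MvPolynomial (Fin n) ℝ) K (C r)) = 0)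
    (p : MvPolynomial (Fin n) ℝ) :
    d (algebraMap _ K p) = ∑ j, algebraMap (MvPolynomial (Fin n) ℝ) K (pderiv j p) •
      d (algebraMap (MvPolynomial (Fin n) ℝ) K (X j)) := by
  classical
  induction p using MvPolynomial.induction_on with
  | C a => simp [hC]
  | add p q hp hq => simp [hadd, hp, hq, add_smul, Finset.sum_add_distrib]
  | mul_X p i hp =>
    rw [map_mul, hmul, hp]
    simp [pderiv_X, Pi.single_apply, Finset.sum_add_distrib, add_smul, Finset.smul_sum,
      apply_ite (algebraMap (MvPolynomial (Fin n) ℝ) K), smul_smul, ite_smul]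

theorem aux_det {n : ℕ} {K M : Type*} [Field K] [AddCommGroup M] [Module K M]
    (N : Matrix (Fin n) (Fin n) K) (hN : N.det ≠ 0) (v : Fin n → M)
    (h : ∀ i, ∑ j, N i j • v j = 0) (k : Fin n) : v k = 0 := by
  have h1 : ∑ i, N⁻¹ k i • ∑ j, N i j • v j = 0 := by simp [h]
  have h2 : ∑ i, N⁻¹ k i • ∑ j, N i j • v j = ∑ j, (N⁻¹ * N) k j • v j := by
    simp only [Finset.smul_sum, smul_smul, Matrix.mul_apply, Finset.sum_smul]
    exact Finset.sum_comm
  rw [h2, Matrix.nonsing_inv_mul _ (Ne.isUnit hN)] at h1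
  simpa [Matrix.one_apply] using h1

open MvPolynomial in
theorem aux_jac {n : ℕ} (F : (Fin n → ℝ) → (Fin n → ℝ))
    (p q : Fin n → MvPolynomial (Fin n) ℝ) (hq : ∀ i x, eval x (q i) ≠ 0)
    (hF : ∀ i x, F x i = eval x (p i) / eval x (q i))
    (hjac : ∃ x : Fin n → ℝ, (fderiv ℝ F x).det ≠ 0) :
    (Matrix.of fun i j => q i * pderiv j (p i) - p i * pderiv j (q i)).det ≠ 0 := by
  obtain ⟨x, hx⟩ := hjac
  set N := (Matrix.of fun i j => q i * pderiv j (p i) - p i * pderiv j (q i)) with hNdef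
  have hd : HasFDerivAt F (ContinuousLinearMap.pi fun i =>
      ∑ j, (eval x (N i j) / (eval x (q i)) ^ 2) •
        (ContinuousLinearMap.proj j : (Fin n → ℝ) →L[ℝ] ℝ)) x := by
    rw [hasFDerivAt_pi']
    intro i
    have h := (aux_hasFDerivAt_eval (p i) x).mul
      ((hasDerivAt_inv (hq i x)).comp_hasFDerivAt x (aux_hasFDerivAt_eval (q i) x))
    have e : (fun y => F y i) = fun y => eval y (p i) / eval y (q i) := funext fun y => hF i y
    rw [e]
    simp only [div_eq_mul_inv]
    refine HasFDerivAt.congr_fderiv h ?_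
    ext v
    simp only [hNdef, Matrix.of_apply]
    simp [Finset.mul_sum]
    rw [← Finset.sum_neg_distrib, ← Finset.sum_add_distrib]
    refine Finset.sum_congr rfl fun j _ => ?_
    have := hq i x
    field_simp
    ring
  rw [hd.fderiv] at hx
  intro h0
  apply hx
  have e : (ContinuousLinearMap.pi fun i =>
      ∑ j, (eval x (N i j) / (eval x (q i)) ^ 2) •
        (ContinuousLinearMap.proj j : (Fin n → ℝ) →L[ℝ] ℝ)).toLinearMap =
      Matrix.toLin' (Matrix.of fun i j => ((eval x (q i)) ^ 2)⁻¹ * (N.map (eval x)) i j) := by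
    ext v i
    simp [Matrix.mulVec, dotProduct, div_eq_inv_mul]
  rw [ContinuousLinearMap.det, e, LinearMap.det_toLin', Matrix.det_mul_column]
  have : (N.map (eval x)).det = eval x N.det := ((eval x).map_det N).symm
  rw [this, h0]
  simp

open MvPolynomial in
theorem aux_separable {n : ℕ} (f : Fin n → FractionRing (MvPolynomial (Fin n) ℝ))
    (p q : Fin n → MvPolynomial (Fin n) ℝ) (hq : ∀ i, q i ≠ 0)
    (hf : ∀ i, f i = algebraMap (MvPolynomial (Fin n) ℝ) (FractionRing (MvPolynomial (Fin n) ℝ)) (p i) /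
      algebraMap (MvPolynomial (Fin n) ℝ) (FractionRing (MvPolynomial (Fin n) ℝ)) (q i))
    (hN : (Matrix.of fun i j => q i * pderiv j (p i) - p i * pderiv j (q i)).det ≠ 0) :
    Algebra.FormallyUnramified (IntermediateField.adjoin ℝ (Set.range f))
      (FractionRing (MvPolynomial (Fin n) ℝ)) := by
  set L := IntermediateField.adjoin ℝ (Set.range f)
  set N := (Matrix.of fun i j => q i * pderiv j (p i) - p i * pderiv j (q i)) with hNdef
  let D := KaehlerDifferential.D L (FractionRing (MvPolynomial (Fin n) ℝ))
  have hL : ∀ a : (FractionRing (MvPolynomial (Fin n) ℝ)), a ∈ L → D a = 0 := fun a ha => D.map_algebraMap ⟨a, ha⟩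
  have hform := aux_derivation (n := n) (K := (FractionRing (MvPolynomial (Fin n) ℝ))) (fun a => D a) (fun a b => D.map_add a b)
    (fun a b => D.leibniz a b) (fun r => hL _ (by
      have : algebraMap (MvPolynomial (Fin n) ℝ) (FractionRing (MvPolynomial (Fin n) ℝ)) (C r) = algebraMap ℝ (FractionRing (MvPolynomial (Fin n) ℝ)) r := by
        rw [IsScalarTower.algebraMap_apply ℝ (MvPolynomial (Fin n) ℝ) (FractionRing (MvPolynomial (Fin n) ℝ))]; rfl
      rw [this]
      exact L.algebraMap_mem r))
  have hX : ∀ k, D (algebraMap (MvPolynomial (Fin n) ℝ) (FractionRing (MvPolynomial (Fin n) ℝ)) (X k)) = 0 := by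
    refine aux_det (N.map (algebraMap (MvPolynomial (Fin n) ℝ) (FractionRing (MvPolynomial (Fin n) ℝ)))) ?_ (fun j => D (algebraMap (MvPolynomial (Fin n) ℝ) (FractionRing (MvPolynomial (Fin n) ℝ)) (X j))) ?_
    · have : (N.map (algebraMap (MvPolynomial (Fin n) ℝ) (FractionRing (MvPolynomial (Fin n) ℝ)))).det = algebraMap (MvPolynomial (Fin n) ℝ) (FractionRing (MvPolynomial (Fin n) ℝ)) N.det :=
        ((algebraMap (MvPolynomial (Fin n) ℝ) (FractionRing (MvPolynomial (Fin n) ℝ))).map_det N).symm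
      rw [this]
      simpa using hN
    · intro i
      have hqi : algebraMap (MvPolynomial (Fin n) ℝ) (FractionRing (MvPolynomial (Fin n) ℝ)) (q i) ≠ 0 := by simpa using hq i
      have h1 : algebraMap (MvPolynomial (Fin n) ℝ) (FractionRing (MvPolynomial (Fin n) ℝ)) (p i) = f i * algebraMap (MvPolynomial (Fin n) ℝ) (FractionRing (MvPolynomial (Fin n) ℝ)) (q i) := by
        rw [hf i]; field_simp
      have h2 : D (algebraMap (MvPolynomial (Fin n) ℝ) (FractionRing (MvPolynomial (Fin n) ℝ)) (p i)) = f i • D (algebraMap (MvPolynomial (Fin n) ℝ) (FractionRing (MvPolynomial (Fin n) ℝ)) (q i)) := by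
        rw [h1, D.leibniz, hL (f i) (IntermediateField.subset_adjoin _ _ ⟨i, rfl⟩)]
        simp
      have h3 : algebraMap (MvPolynomial (Fin n) ℝ) (FractionRing (MvPolynomial (Fin n) ℝ)) (q i) • D (algebraMap (MvPolynomial (Fin n) ℝ) (FractionRing (MvPolynomial (Fin n) ℝ)) (p i)) -
          algebraMap (MvPolynomial (Fin n) ℝ) (FractionRing (MvPolynomial (Fin n) ℝ)) (p i) • D (algebraMap (MvPolynomial (Fin n) ℝ) (FractionRing (MvPolynomial (Fin n) ℝ)) (q i)) = 0 := by
        rw [h2, h1, smul_smul, mul_comm, sub_self]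
      rw [hform (p i), hform (q i)] at h3
      rw [← h3]
      simp only [Matrix.map_apply, hNdef, Matrix.of_apply, map_sub, map_mul, sub_smul,
        Finset.sum_sub_distrib, Finset.smul_sum, smul_smul]
  have hP : ∀ r, D (algebraMap (MvPolynomial (Fin n) ℝ) (FractionRing (MvPolynomial (Fin n) ℝ)) r) = 0 := fun r => by
    rw [hform r]; simp [hX]
  have hD : ∀ a, D a = 0 := by
    intro a
    obtain ⟨r, s, hs, rfl⟩ := IsFractionRing.div_surjective (A := MvPolynomial (Fin n) ℝ) a
    have hs' : algebraMap (MvPolynomial (Fin n) ℝ) (FractionRing (MvPolynomial (Fin n) ℝ)) s ≠ 0 := by simpa using nonZeroDivisors.ne_zero hs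
    have h := hP r
    have e : algebraMap (MvPolynomial (Fin n) ℝ) (FractionRing (MvPolynomial (Fin n) ℝ)) r = algebraMap (MvPolynomial (Fin n) ℝ) (FractionRing (MvPolynomial (Fin n) ℝ)) s * (algebraMap (MvPolynomial (Fin n) ℝ) (FractionRing (MvPolynomial (Fin n) ℝ)) r / algebraMap (MvPolynomial (Fin n) ℝ) (FractionRing (MvPolynomial (Fin n) ℝ)) s) := by
      field_simp
    rw [e, D.leibniz, hP s, smul_zero, add_zero] at h
    exact (smul_eq_zero.mp h).resolve_left hs'
  refine ⟨?_⟩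
  rw [← Submodule.subsingleton_iff (FractionRing (MvPolynomial (Fin n) ℝ)), ← subsingleton_iff_bot_eq_top,
    ← KaehlerDifferential.span_range_derivation, eq_comm, Submodule.span_eq_bot]
  rintro _ ⟨a, rfl⟩
  exact hD a

theorem aux_primitive {n : ℕ}
    (L : IntermediateField ℝ (FractionRing (MvPolynomial (Fin n) ℝ)))
    [FiniteDimensional L (FractionRing (MvPolynomial (Fin n) ℝ))] :
    ∃ r : MvPolynomial (Fin n) ℝ, IntermediateField.adjoin L
      {algebraMap (MvPolynomial (Fin n) ℝ) (FractionRing (MvPolynomial (Fin n) ℝ)) r} = ⊤ := by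
  have hfin : Finite (IntermediateField L (FractionRing (MvPolynomial (Fin n) ℝ))) :=
    (Field.exists_primitive_element_iff_finite_intermediateField L (FractionRing (MvPolynomial (Fin n) ℝ))).mp
      ⟨inferInstance, Field.exists_primitive_element L (FractionRing (MvPolynomial (Fin n) ℝ))⟩
  by_contra! hcon
  let φ : MvPolynomial (Fin n) ℝ →ₗ[ℝ] (FractionRing (MvPolynomial (Fin n) ℝ)) := (IsScalarTower.toAlgHom ℝ _ (FractionRing (MvPolynomial (Fin n) ℝ))).toLinearMap
  let g : IntermediateField L (FractionRing (MvPolynomial (Fin n) ℝ)) → Submodule ℝ (MvPolynomial (Fin n) ℝ) := fun E =>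
    (Subalgebra.toSubmodule (E.restrictScalars ℝ).toSubalgebra).comap φ
  have hg : ∀ E r, r ∈ g E ↔ algebraMap (MvPolynomial (Fin n) ℝ) (FractionRing (MvPolynomial (Fin n) ℝ)) r ∈ E := fun E r => Iff.rfl
  let s : Set (Submodule ℝ (MvPolynomial (Fin n) ℝ)) := g '' {E | E ≠ ⊤}
  have hs : s.Finite := Set.toFinite _
  refine Subspace.biUnion_ne_univ_of_top_notMem (s := hs.toFinset) ?_ ?_
  · simp only [Set.Finite.mem_toFinset]
    rintro ⟨E, hE, h⟩
    apply hE
    rw [eq_top_iff]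
    rintro a -
    have hP : ∀ r, algebraMap (MvPolynomial (Fin n) ℝ) (FractionRing (MvPolynomial (Fin n) ℝ)) r ∈ E := fun r => (hg E r).1 (h ▸ trivial)
    obtain ⟨r, t, ht, rfl⟩ := IsFractionRing.div_surjective (A := MvPolynomial (Fin n) ℝ) a
    exact E.div_mem (hP r) (hP t)
  · rw [Set.eq_univ_iff_forall]
    intro r
    simp only [Set.mem_iUnion, Set.Finite.mem_toFinset]
    exact ⟨g _, ⟨_, hcon r, rfl⟩, (hg _ _).2 (IntermediateField.mem_adjoin_simple_self L _)⟩

open MvPolynomial in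
theorem aux_defined {n : ℕ} (f : Fin n → FractionRing (MvPolynomial (Fin n) ℝ))
    (hf : ∀ i, ∃ p q : MvPolynomial (Fin n) ℝ, (∀ x, eval x q ≠ 0) ∧
      f i = algebraMap (MvPolynomial (Fin n) ℝ) (FractionRing (MvPolynomial (Fin n) ℝ)) p / algebraMap (MvPolynomial (Fin n) ℝ) _ q)
    (a : FractionRing (MvPolynomial (Fin n) ℝ)) (ha : a ∈ Algebra.adjoin ℝ (Set.range f)) :
    ∃ p q : MvPolynomial (Fin n) ℝ, (∀ x, eval x q ≠ 0) ∧
      a = algebraMap (MvPolynomial (Fin n) ℝ) (FractionRing (MvPolynomial (Fin n) ℝ)) p / algebraMap (MvPolynomial (Fin n) ℝ) _ q := by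
  have hne : ∀ q : MvPolynomial (Fin n) ℝ, (∀ x, eval x q ≠ 0) →
      algebraMap (MvPolynomial (Fin n) ℝ) (FractionRing (MvPolynomial (Fin n) ℝ)) q ≠ 0 := by
    intro q hq h
    have : q = 0 := by simpa using h
    exact hq 0 (by simp [this])
  induction ha using Algebra.adjoin_induction with
  | mem x hx => obtain ⟨i, rfl⟩ := hx; exact hf i
  | algebraMap r =>
    refine ⟨C r, 1, by simp, ?_⟩
    rw [IsScalarTower.algebraMap_apply ℝ (MvPolynomial (Fin n) ℝ)]
    simp [MvPolynomial.algebraMap_eq]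
  | add x y _ _ hx hy =>
    obtain ⟨p, q, hq, rfl⟩ := hx
    obtain ⟨p', q', hq', rfl⟩ := hy
    refine ⟨p * q' + q * p', q * q', fun x => by simp [hq x, hq' x], ?_⟩
    rw [div_add_div _ _ (hne q hq) (hne q' hq')]
    simp
  | mul x y _ _ hx hy =>
    obtain ⟨p, q, hq, rfl⟩ := hx
    obtain ⟨p', q', hq', rfl⟩ := hy
    refine ⟨p * p', q * q', fun x => by simp [hq x, hq' x], ?_⟩
    rw [div_mul_div_comm]
    simp

open scoped IntermediateField.algebraAdjoinAdjoin in
theorem aux_alg {K : Type*} [Field K] [Algebra ℝ K] (S : Set K) (a : K)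
    (h : IsAlgebraic (IntermediateField.adjoin ℝ S) a) : IsAlgebraic (Algebra.adjoin ℝ S) a :=
  (IsFractionRing.isAlgebraic_iff (Algebra.adjoin ℝ S) (IntermediateField.adjoin ℝ S) K).2 h

/-- For an everywhere defined real rational map `F : ℝⁿ → ℝⁿ` whose Jacobian
determinant is not identically zero, there is a primitive element `t` for the extension
`ℝ(F) ⊆ ℝ(x₁, …, xₙ)` which is defined everywhere on `ℝⁿ` and integral over
`ℝ[f₁, …, fₙ]`. -/
theorem exists_everywhere_defined_integral_primitive_element
    (n : ℕ) (F : (Fin n → ℝ) → (Fin n → ℝ))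
    (f : Fin n → FractionRing (MvPolynomial (Fin n) ℝ))
    (hF : IsEverywhereDefRatMap n F f)
    (hjac : ∃ x : Fin n → ℝ, (fderiv ℝ F x).det ≠ 0) :
    ∃ t : FractionRing (MvPolynomial (Fin n) ℝ),
      (∃ p q : MvPolynomial (Fin n) ℝ,
        (∀ x : Fin n → ℝ, MvPolynomial.eval x q ≠ 0) ∧
        t = algebraMap (MvPolynomial (Fin n) ℝ) (FractionRing (MvPolynomial (Fin n) ℝ)) p /
          algebraMap (MvPolynomial (Fin n) ℝ) (FractionRing (MvPolynomial (Fin n) ℝ)) q) ∧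
      IsIntegral (Algebra.adjoin ℝ (Set.range f)) t ∧
      IntermediateField.adjoin ℝ (Set.range f ∪ {t}) = ⊤ := by
  choose p q hq hf hFx using hF
  have hq0 : ∀ i, q i ≠ 0 := fun i h => hq i 0 (by simp [h])
  have hun := aux_separable f p q hq0 hf (aux_jac F p q hq hFx hjac)
  set L := IntermediateField.adjoin ℝ (Set.range f) with hLdef
  have h0 : Algebra.EssFiniteType ℝ (FractionRing (MvPolynomial (Fin n) ℝ)) :=
    have : Algebra.EssFiniteType (MvPolynomial (Fin n) ℝ) (FractionRing (MvPolynomial (Fin n) ℝ)) :=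
      .of_isLocalization _ (nonZeroDivisors _)
    .comp ℝ (MvPolynomial (Fin n) ℝ) (FractionRing (MvPolynomial (Fin n) ℝ))
  have h1 : Algebra.EssFiniteType L (FractionRing (MvPolynomial (Fin n) ℝ)) := .of_comp ℝ L (FractionRing (MvPolynomial (Fin n) ℝ))
  have h2 : FiniteDimensional L (FractionRing (MvPolynomial (Fin n) ℝ)) := Algebra.FormallyUnramified.finite_of_free L (FractionRing (MvPolynomial (Fin n) ℝ))
  obtain ⟨r, hr⟩ := aux_primitive L
  have halg : IsAlgebraic (Algebra.adjoin ℝ (Set.range f)) (algebraMap _ (FractionRing (MvPolynomial (Fin n) ℝ)) r) := by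
    have h3 : IsAlgebraic L (algebraMap _ (FractionRing (MvPolynomial (Fin n) ℝ)) r) := Algebra.IsAlgebraic.isAlgebraic _
    exact aux_alg _ _ h3
  obtain ⟨a, ha0, ha⟩ := halg.exists_integral_multiple
  refine ⟨a • algebraMap _ (FractionRing (MvPolynomial (Fin n) ℝ)) r, ?_, ha, ?_⟩
  · obtain ⟨p', q', hq', h⟩ := aux_defined f (fun i => ⟨p i, q i, hq i, hf i⟩) a a.2
    refine ⟨p' * r, q', hq', ?_⟩
    rw [Subalgebra.smul_def, h, smul_eq_mul, map_mul, div_mul_eq_mul_div]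
  · rw [← IntermediateField.adjoin_adjoin_left, ← hLdef]
    have haL : (a : (FractionRing (MvPolynomial (Fin n) ℝ))) ∈ L := IntermediateField.algebra_adjoin_le_adjoin _ _ a.2
    have ha0' : (a : (FractionRing (MvPolynomial (Fin n) ℝ))) ≠ 0 := by simpa using ha0
    have : IntermediateField.adjoin L {a • algebraMap _ (FractionRing (MvPolynomial (Fin n) ℝ)) r} = ⊤ := by
      rw [eq_top_iff, ← hr, IntermediateField.adjoin_simple_le_iff]
      have hm := IntermediateField.mem_adjoin_simple_self L (a • algebraMap _ (FractionRing (MvPolynomial (Fin n) ℝ)) r)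
      have hm2 := (IntermediateField.adjoin L {a • algebraMap _ (FractionRing (MvPolynomial (Fin n) ℝ)) r}).algebraMap_mem ⟨a, haL⟩
      have hm3 := IntermediateField.div_mem _ hm hm2
      convert hm3 using 1
      change _ = (a : (FractionRing (MvPolynomial (Fin n) ℝ))) * _ / (a : (FractionRing (MvPolynomial (Fin n) ℝ)))
      field_simp
    rw [this]
    rfl
end

section
/- Let F : ℝ^n → ℝ^n be an everywhere defined real rational map whose Jacobian determinant vanishes nowhere on ℝ^n. If F is injective (equivalently, F has a global inverse), then the identity is the only field automorphism of ℝ(x_1, …, x_n) that fixes every element of ℝ(F). -/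
open MvPolynomial in
theorem aux_eval (n : ℕ) (a b : Fin n → MvPolynomial (Fin n) ℝ) (hb : ∀ i, b i ≠ 0)
    (g : Fin n → FractionRing (MvPolynomial (Fin n) ℝ))
    (hg : ∀ i, g i * algebraMap (MvPolynomial (Fin n) ℝ) _ (b i) = algebraMap _ _ (a i))
    (P : MvPolynomial (Fin n) ℝ) :
    ∃ c d : MvPolynomial (Fin n) ℝ, d ≠ 0 ∧
      aeval g P * algebraMap _ (FractionRing (MvPolynomial (Fin n) ℝ)) d = algebraMap _ _ c ∧
      ∀ x : Fin n → ℝ, (∀ i, eval x (b i) ≠ 0) → eval x d ≠ 0 ∧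
        eval (fun i => eval x (a i) / eval x (b i)) P * eval x d = eval x c := by
  induction P using MvPolynomial.induction_on with
  | C r =>
    refine ⟨C r, 1, one_ne_zero, ?_, ?_⟩
    · rw [map_one, mul_one, aeval_C, IsScalarTower.algebraMap_apply ℝ (MvPolynomial (Fin n) ℝ)]
      rfl
    · intro x hx
      simp
  | add p q hp hq =>
    obtain ⟨c, d, hd, h1, h2⟩ := hp
    obtain ⟨c', d', hd', h1', h2'⟩ := hq
    refine ⟨c * d' + c' * d, d * d', mul_ne_zero hd hd', ?_, ?_⟩
    · simp only [map_add, map_mul, ← h1, ← h1']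
      ring
    · intro x hx
      obtain ⟨h3, h4⟩ := h2 x hx
      obtain ⟨h3', h4'⟩ := h2' x hx
      refine ⟨by rw [map_mul]; exact mul_ne_zero h3 h3', ?_⟩
      simp only [map_add, map_mul, ← h4, ← h4']
      ring
  | mul_X p i hp =>
    obtain ⟨c, d, hd, h1, h2⟩ := hp
    refine ⟨c * a i, d * b i, mul_ne_zero hd (hb i), ?_, ?_⟩
    · simp only [map_mul, ← h1, ← hg, aeval_X]
      ring
    · intro x hx
      obtain ⟨h3, h4⟩ := h2 x hx
      refine ⟨by rw [map_mul]; exact mul_ne_zero h3 (hx i), ?_⟩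
      have := hx i
      simp only [map_mul, ← h4, eval_X]
      field_simp

/-- If an everywhere defined real rational map `F : ℝⁿ → ℝⁿ` with nowhere
vanishing Jacobian determinant is injective, then the identity is the only field
automorphism of `ℝ(x₁, …, xₙ)` fixing every element of `ℝ(F)`. -/
theorem automorphism_trivial_of_injective
    (n : ℕ) (F : (Fin n → ℝ) → (Fin n → ℝ))
    (f : Fin n → FractionRing (MvPolynomial (Fin n) ℝ))
    (hF : IsEverywhereDefRatMap n F f)
    (hjac : ∀ x : Fin n → ℝ, (fderiv ℝ F x).det ≠ 0)
    (hinj : Function.Injective F) :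
    ∀ σ : FractionRing (MvPolynomial (Fin n) ℝ) ≃+* FractionRing (MvPolynomial (Fin n) ℝ),
      (∀ r ∈ IntermediateField.adjoin ℝ (Set.range f), σ r = r) →
      σ = RingEquiv.refl (FractionRing (MvPolynomial (Fin n) ℝ)) := by
  intro σ hσ
  let R := MvPolynomial (Fin n) ℝ
  let K := FractionRing R
  have hinjK : Function.Injective (algebraMap R K) := IsFractionRing.injective R K
  have hex : ∀ i, ∃ a b : R, b ≠ 0 ∧
      σ (algebraMap R K (MvPolynomial.X i)) * algebraMap R K b = algebraMap R K a := by
    intro i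
    obtain ⟨a, b, hb, h⟩ := IsFractionRing.div_surjective (A := R)
      (σ (algebraMap R K (MvPolynomial.X i)))
    have hb0 : b ≠ 0 := nonZeroDivisors.ne_zero hb
    have hb1 : algebraMap R K b ≠ 0 := by
      rw [Ne, map_eq_zero_iff _ hinjK]; exact hb0
    exact ⟨a, b, hb0, by rw [← h]; exact div_mul_cancel₀ _ hb1⟩
  choose a b hb hg using hex
  have hC : ∀ r : ℝ, σ (algebraMap R K (MvPolynomial.C r)) = algebraMap R K (MvPolynomial.C r) := by
    intro r
    apply hσ
    have : algebraMap R K (MvPolynomial.C r) = algebraMap ℝ K r := by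
      rw [IsScalarTower.algebraMap_apply ℝ R K]; rfl
    rw [this]
    exact IntermediateField.algebraMap_mem _ r
  have hae : ∀ P : R, σ (algebraMap R K P) =
      MvPolynomial.aeval (fun i => σ (algebraMap R K (MvPolynomial.X i))) P := by
    intro P
    induction P using MvPolynomial.induction_on with
    | C r =>
      rw [hC, MvPolynomial.aeval_C, IsScalarTower.algebraMap_apply ℝ R K]; rfl
    | add p q hp hq => simp only [map_add, hp, hq]
    | mul_X p i hp => simp only [map_mul, hp, MvPolynomial.aeval_X]
  have hfix : ∀ x : Fin n → ℝ, (∀ i, MvPolynomial.eval x (b i) ≠ 0) →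
      (fun i => MvPolynomial.eval x (a i) / MvPolynomial.eval x (b i)) = x := by
    intro x hx
    apply hinj
    funext j
    obtain ⟨p, q, hq, hf, hFx⟩ := hF j
    rw [hFx, hFx]
    have hs : σ (f j) = f j :=
      hσ _ (IntermediateField.subset_adjoin ℝ _ (Set.mem_range_self j))
    have hq0 : q ≠ 0 := by
      rintro rfl
      exact hq x (map_zero _)
    have hq1 : algebraMap R K q ≠ 0 := by
      rw [Ne, map_eq_zero_iff _ hinjK]; exact hq0
    have hq2 : σ (algebraMap R K q) ≠ 0 := by
      rw [Ne, map_eq_zero_iff _ σ.injective]; exact hq1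
    rw [hf, map_div₀, div_eq_div_iff hq2 hq1, hae, hae] at hs
    obtain ⟨c, d, hd, h1, h2⟩ := aux_eval n a b hb _ hg p
    obtain ⟨c', d', hd', h1', h2'⟩ := aux_eval n a b hb _ hg q
    obtain ⟨h3, h4⟩ := h2 x hx
    obtain ⟨h3', h4'⟩ := h2' x hx
    have key : c * q * d' = p * c' * d := by
      apply hinjK
      simp only [map_mul]
      rw [← h1, ← h1']
      linear_combination (algebraMap R K d * algebraMap R K d') * hs
    have key2 := congrArg (MvPolynomial.eval x) key
    simp only [map_mul] at key2
    rw [← h4, ← h4'] at key2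
    rw [div_eq_div_iff (hq _) (hq _)]
    apply mul_right_cancel₀ (mul_ne_zero h3 h3')
    linear_combination key2
  have hX : ∀ i, σ (algebraMap R K (MvPolynomial.X i)) = algebraMap R K (MvPolynomial.X i) := by
    intro i
    have hz : (∏ j, b j) * (a i - MvPolynomial.X i * b i) = 0 := by
      apply MvPolynomial.funext
      intro x
      rw [map_mul, map_zero, mul_eq_zero]
      by_cases hx : ∀ j, MvPolynomial.eval x (b j) ≠ 0
      · right
        have h := congrFun (hfix x hx) i
        rw [div_eq_iff (hx i)] at h
        simp [h]
      · left
        push Not at hx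
        obtain ⟨j, hj⟩ := hx
        rw [map_prod]
        exact Finset.prod_eq_zero (Finset.mem_univ j) hj
    have hz2 : a i = MvPolynomial.X i * b i := by
      rcases mul_eq_zero.mp hz with h | h
      · exact absurd h (Finset.prod_ne_zero_iff.mpr fun j _ => hb j)
      · exact sub_eq_zero.mp h
    have hb1 : algebraMap R K (b i) ≠ 0 := by
      rw [Ne, map_eq_zero_iff _ hinjK]; exact hb i
    apply mul_right_cancel₀ hb1
    rw [hg, hz2, map_mul]
  have hP : ∀ P : R, σ (algebraMap R K P) = algebraMap R K P := by
    intro P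
    induction P using MvPolynomial.induction_on with
    | C r => exact hC r
    | add p q hp hq => simp only [map_add, hp, hq]
    | mul_X p i hp => simp only [map_mul, hp, hX]
  ext z
  obtain ⟨u, v, hv, rfl⟩ := IsFractionRing.div_surjective (A := R) z
  rw [map_div₀, hP, hP]
  rfl
end

section
/- Work in ℝ[x, y] with fraction field ℝ(x, y). Set t = xy − 1, h = t(xt + 1), f = (xt + 1)²(t² + y), P = f + h, q = −t² − 6th(h + 1), u = 170fh + 91h² + 195fh² + 69h³ + 75fh³ + (75/4)h⁴, and Q = q − u. Then for every subfield k of ℝ (in particular k = ℝ and k = ℚ), the field k(x, y) is a vector space of dimension exactly 6 over its subfield k(P, Q); that is, the function field extension associated to the Pinchuk map F = (P, Q) has degree 6, even though F is generically two-to-one as a map ℝ² → ℝ². -/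
noncomputable section

open MvPolynomial

/-- `t = xy − 1`. -/
def pinchukT (k : Type*) [Field k] : MvPolynomial (Fin 2) k := X 0 * X 1 - 1

/-- `h = t(xt + 1)`. -/
def pinchukH (k : Type*) [Field k] : MvPolynomial (Fin 2) k :=
  pinchukT k * (X 0 * pinchukT k + 1)

/-- `f = (xt + 1)²(t² + y)`. -/
def pinchukF (k : Type*) [Field k] : MvPolynomial (Fin 2) k :=
  (X 0 * pinchukT k + 1) ^ 2 * (pinchukT k ^ 2 + X 1)

/-- `P = f + h`. -/
def pinchukP (k : Type*) [Field k] : MvPolynomial (Fin 2) k := pinchukF k + pinchukH k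

/-- `q = −t² − 6th(h + 1)`. -/
def pinchukq (k : Type*) [Field k] : MvPolynomial (Fin 2) k :=
  -pinchukT k ^ 2 - 6 * pinchukT k * pinchukH k * (pinchukH k + 1)

/-- `u = 170fh + 91h² + 195fh² + 69h³ + 75fh³ + (75/4)h⁴`. -/
def pinchukU (k : Type*) [Field k] : MvPolynomial (Fin 2) k :=
  170 * pinchukF k * pinchukH k + 91 * pinchukH k ^ 2 + 195 * pinchukF k * pinchukH k ^ 2 +
    69 * pinchukH k ^ 3 + 75 * pinchukF k * pinchukH k ^ 3 + C (75 / 4 : k) * pinchukH k ^ 4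

/-- `Q = q − u`. -/
def pinchukQ (k : Type*) [Field k] : MvPolynomial (Fin 2) k := pinchukq k - pinchukU k

open IntermediateField in
theorem pk_finrank {K L : Type*} [Field K] [Field L] [Algebra K L] (h z : L)
    (ht : Transcendental K h) (htop : K⟮h⟯ = ⊤) (A B : Polynomial K) (hB : B ≠ 0)
    (hAB : IsCoprime A B) (hz : z * Polynomial.aeval h B = Polynomial.aeval h A) :
    Module.finrank K⟮z⟯ L = max A.natDegree B.natDegree := by
  classical
  let e : RatFunc K ≃ₐ[K] L :=
    (RatFunc.algEquivOfTranscendental h ht).trans ((equivOfEq htop).trans topEquiv)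
  have he : ∀ g : Polynomial K, e (algebraMap _ _ g) = Polynomial.aeval h g := by
    intro g
    simp [e, RatFunc.algEquivOfTranscendental_algebraMap]
  let f : RatFunc K := algebraMap _ _ A / algebraMap _ _ B
  have hB' : Polynomial.aeval h B ≠ 0 := by
    intro h0
    exact hB ((transcendental_iff.mp ht) B h0)
  have hf : e f = z := by
    simp only [f, map_div₀, he]
    rw [← hz]; field_simp
  have hmap : K⟮f⟯.map e.toAlgHom = K⟮z⟯ := by
    rw [IntermediateField.adjoin_map, Set.image_singleton]
    change K⟮e f⟯ = _
    rw [hf]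
  have h1 : Module.finrank K⟮f⟯ (RatFunc K) = Module.finrank K⟮z⟯ L := by
    rw [← hmap]
    exact Algebra.finrank_eq_of_equiv_equiv (intermediateFieldMap e K⟮f⟯).toRingEquiv
      e.toRingEquiv (by ext; rfl)
  rw [← h1, RatFunc.finrank_eq_max_natDegree]
  have hg : gcd A B = 1 := by
    rw [← normalize_gcd]
    exact normalize_eq_one.mpr (by
      rw [gcd_isUnit_iff]; exact hAB)
  have hl : B.leadingCoeff⁻¹ ≠ 0 := by simpa using hB
  simp only [f]
  rw [RatFunc.num_div, RatFunc.denom_div _ hB, hg]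
  simp [Polynomial.natDegree_C_mul hl]

open IntermediateField in
open scoped algebraAdjoinAdjoin in
theorem pk_trans {k L : Type} [Field k] [Field L] [Algebra k L] (p h : L)
    (htop : k⟮p⟯⟮h⟯ = ⊤) (htr : 2 ≤ Algebra.trdeg k L) : Transcendental k⟮p⟯ h := by
  intro halg
  have a1 : Algebra.IsAlgebraic k⟮p⟯ k⟮p⟯⟮h⟯ := isAlgebraic_adjoin_simple halg.isIntegral
  have a2 : Algebra.IsAlgebraic k⟮p⟯ L :=
    ((equivOfEq htop).trans topEquiv).isAlgebraic
  have a5 : Algebra.IsAlgebraic (Algebra.adjoin k {p}) L :=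
    (IsFractionRing.comap_isAlgebraic_iff (A := Algebra.adjoin k {p}) (K := k⟮p⟯)
      (C := L)).mpr a2
  have a6 := Algebra.IsAlgebraic.trdeg_le_cardinalMk k ({p} : Set L)
  rw [Cardinal.mk_singleton] at a6
  have := htr.trans a6
  norm_num at this

theorem pk_trdeg (k : Type) [Field k] :
    2 ≤ Algebra.trdeg k (FractionRing (MvPolynomial (Fin 2) k)) := by
  have h := (MvPolynomial.algebraicIndependent_X (Fin 2) k).map'
    (f := IsScalarTower.toAlgHom k (MvPolynomial (Fin 2) k)
      (FractionRing (MvPolynomial (Fin 2) k))) (IsFractionRing.injective _ _)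
  simpa using h.cardinalMk_le_trdeg

theorem pk_top (k : Type) [Field k] (M : IntermediateField k (FractionRing (MvPolynomial (Fin 2) k)))
    (hM : ∀ i, algebraMap (MvPolynomial (Fin 2) k) _ (X i) ∈ M) : M = ⊤ := by
  have key : ∀ p : MvPolynomial (Fin 2) k, algebraMap (MvPolynomial (Fin 2) k) _ p ∈ M := by
    intro p
    induction p using MvPolynomial.induction_on with
    | C a => exact M.algebraMap_mem a
    | add p q hp hq => rw [map_add]; exact M.add_mem hp hq
    | mul_X p i hp => rw [map_mul]; exact M.mul_mem hp (hM i)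
  rw [eq_top_iff]
  rintro z -
  obtain ⟨a, b, -, rfl⟩ := IsFractionRing.div_surjective (MvPolynomial (Fin 2) k) z
  exact M.div_mem (key a) (key b)

theorem pk_ne {k : Type} [Field k] (p : MvPolynomial (Fin 2) k) (a b : k)
    (h : MvPolynomial.eval ![a, b] p ≠ 0) :
    algebraMap (MvPolynomial (Fin 2) k) (FractionRing (MvPolynomial (Fin 2) k)) p ≠ 0 := by
  intro h0
  have : p = 0 := (IsFractionRing.injective (MvPolynomial (Fin 2) k)
    (FractionRing (MvPolynomial (Fin 2) k))) (by rw [h0, map_zero])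
  simp [this] at h

/-- numerator of `Q` as a rational function of `h` over `k(P)` -/
def pkNum {K : Type} [Field K] (p : K) : Polynomial K :=
  let x : Polynomial K := Polynomial.X
  let d : Polynomial K := Polynomial.C p - x
  let T : Polynomial K := x * (Polynomial.C p - 2 * x - x ^ 2);
  0 - T * T - 6 * T * d * x * (x + 1) - d ^ 2 * (170 * d * x + 91 * x ^ 2 + 195 * d * x ^ 2 +
    69 * x ^ 3 + 75 * d * x ^ 3 + Polynomial.C (75 / 4) * x ^ 4)

theorem pkNum_deg {K : Type} [Field K] [CharZero K] (p : K) : (pkNum p).natDegree = 6 := by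
  unfold pkNum
  dsimp only
  compute_degree
  all_goals norm_num

theorem pkNum_coprime {K : Type} [Field K] (p : K) (h0 : p ≠ 0) (h1 : p + 1 ≠ 0) :
    IsCoprime (pkNum p) ((Polynomial.X - Polynomial.C p) ^ 2) := by
  refine IsCoprime.pow_right (IsCoprime.symm ?_)
  rw [(Polynomial.irreducible_X_sub_C p).coprime_iff_not_dvd, Polynomial.dvd_iff_isRoot]
  have : Polynomial.eval p (pkNum p) = -(p ^ 2 * (p + 1)) ^ 2 := by
    simp [pkNum]; ring
  rw [Polynomial.IsRoot, this]
  simp [h0, h1]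

theorem pk_id_t {L : Type} [Field L] (x y t h f : L) (ht : t = x * y - 1)
    (hh : h = t * (x * t + 1)) (hf : f = (x * t + 1) ^ 2 * (t ^ 2 + y)) :
    t * f = h * f - h ^ 2 * (h + 1) := by
  subst hf hh ht; ring

open IntermediateField in
theorem pk_main (k : Type) [Field k] [CharZero k] :
    Module.finrank
      (IntermediateField.adjoin k
        ({algebraMap (MvPolynomial (Fin 2) k) (FractionRing (MvPolynomial (Fin 2) k))
            (pinchukP k),
          algebraMap (MvPolynomial (Fin 2) k) (FractionRing (MvPolynomial (Fin 2) k))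
            (pinchukQ k)} : Set (FractionRing (MvPolynomial (Fin 2) k))))
      (FractionRing (MvPolynomial (Fin 2) k)) = 6 := by
  set φ := algebraMap (MvPolynomial (Fin 2) k) (FractionRing (MvPolynomial (Fin 2) k)) with hφ
  have : CharZero (FractionRing (MvPolynomial (Fin 2) k)) :=
    charZero_of_injective_algebraMap (algebraMap k _).injective
  obtain ⟨x, hx⟩ : ∃ x, x = φ (X 0) := ⟨_, rfl⟩
  obtain ⟨y, hy⟩ : ∃ y, y = φ (X 1) := ⟨_, rfl⟩
  obtain ⟨t, ht⟩ : ∃ t, t = φ (pinchukT k) := ⟨_, rfl⟩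
  obtain ⟨h, hh⟩ : ∃ h, h = φ (pinchukH k) := ⟨_, rfl⟩
  obtain ⟨f, hf⟩ : ∃ f, f = φ (pinchukF k) := ⟨_, rfl⟩
  obtain ⟨P, hP⟩ : ∃ P, P = φ (pinchukP k) := ⟨_, rfl⟩
  obtain ⟨Q, hQ⟩ : ∃ Q, Q = φ (pinchukQ k) := ⟨_, rfl⟩
  have x0 : x ≠ 0 := hx ▸ pk_ne _ 1 2 (by simp)
  have t0 : t ≠ 0 := ht ▸ pk_ne _ 1 2 (by simp [pinchukT]; norm_num)
  have f0 : f ≠ 0 := hf ▸ pk_ne _ 1 2 (by simp [pinchukT, pinchukF]; try norm_num)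
  have P0 : P ≠ 0 := hP ▸ pk_ne _ 0 1 (by simp [pinchukT, pinchukF, pinchukP, pinchukH])
  have P1 : P + 1 ≠ 0 := by
    have := pk_ne (pinchukP k + 1) 0 1
      (by simp [pinchukT, pinchukF, pinchukP, pinchukH]; try norm_num)
    rwa [map_add, map_one, ← hφ, ← hP] at this
  have et : t = x * y - 1 := by simp [ht, hx, hy, pinchukT]
  have eh : h = t * (x * t + 1) := by simp [ht, hh, hx, pinchukH]
  have ef : f = (x * t + 1) ^ 2 * (t ^ 2 + y) := by simp [ht, hf, hx, hy, pinchukF]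
  have eP : P = f + h := by simp [hP, hf, hh, pinchukP]
  have eC : φ (C (75 / 4 : k)) = 75 / 4 := by
    rw [hφ, ← MvPolynomial.algebraMap_eq, ← IsScalarTower.algebraMap_apply, map_div₀, map_ofNat,
      map_ofNat]
  have eQ : Q = (-t ^ 2 - 6 * t * h * (h + 1)) - (170 * f * h + 91 * h ^ 2 + 195 * f * h ^ 2 +
      69 * h ^ 3 + 75 * f * h ^ 3 + 75 / 4 * h ^ 4) := by
    simp only [hQ, ht, hf, hh, pinchukQ, pinchukq, pinchukU, map_sub, map_add, map_mul, map_pow,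
      map_neg, map_ofNat, map_one, eC]
  have etf := pk_id_t x y t h f et eh ef
  rw [← hP, ← hQ, ← Set.singleton_union, ← adjoin_adjoin_left]
  have htop : k⟮P⟯⟮h⟯ = ⊤ := by
    rw [← restrictScalars_eq_top_iff (K := k), adjoin_adjoin_left]
    set M := adjoin k ({P} ∪ {h} : Set (FractionRing (MvPolynomial (Fin 2) k)))
    have mP : P ∈ M := subset_adjoin _ _ (by simp)
    have mh : h ∈ M := subset_adjoin _ _ (by simp)
    have mf : f ∈ M := by
      rw [show f = P - h by rw [eP]; ring]; exact M.sub_mem mP mh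
    have mt : t ∈ M := by
      rw [show t = h - h ^ 2 * (h + 1) / f by field_simp; rw [etf]; ring]
      exact M.sub_mem mh (M.div_mem (M.mul_mem (M.pow_mem mh 2) (M.add_mem mh M.one_mem)) mf)
    have mx : x ∈ M := by
      rw [show x = (h - t) / t ^ 2 by rw [eh]; field_simp; ring]
      exact M.div_mem (M.sub_mem mh mt) (M.pow_mem mt 2)
    have my : y ∈ M := by
      rw [show y = (t + 1) / x by rw [et]; field_simp; ring]
      exact M.div_mem (M.add_mem mt M.one_mem) mx
    apply pk_top
    intro i
    fin_cases i
    · exact hx ▸ mx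
    · exact hy ▸ my
  have htr := pk_trans P h htop (pk_trdeg k)
  let p : k⟮P⟯ := AdjoinSimple.gen k P
  have hp : algebraMap k⟮P⟯ (FractionRing (MvPolynomial (Fin 2) k)) p = P :=
    AdjoinSimple.algebraMap_gen k P
  have p0 : p ≠ 0 := fun h => P0 (by rw [← hp, h, map_zero])
  have p1 : p + 1 ≠ 0 := fun h => P1 (by
    rw [← hp, ← map_one (algebraMap k⟮P⟯ _), ← map_add, h, map_zero])
  have := pk_finrank h Q htr htop (pkNum p) ((Polynomial.X - Polynomial.C p) ^ 2)
    (pow_ne_zero _ (Polynomial.X_sub_C_ne_zero p)) (pkNum_coprime p p0 p1) (by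
      have e1 : Polynomial.aeval h (pkNum p) = 0 - ((h * (P - 2 * h - h ^ 2)) * (h * (P - 2 * h - h ^ 2)))
          - 6 * (h * (P - 2 * h - h ^ 2)) * (P - h) * h * (h + 1)
          - (P - h) ^ 2 * (170 * (P - h) * h + 91 * h ^ 2 + 195 * (P - h) * h ^ 2 +
            69 * h ^ 3 + 75 * (P - h) * h ^ 3 + 75 / 4 * h ^ 4) := by
        simp only [pkNum, map_sub, map_add, map_mul, map_pow,
          map_neg, map_ofNat, map_one, map_zero, Polynomial.aeval_X, Polynomial.aeval_C, hp, map_div₀]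
      have e2 : h * (P - 2 * h - h ^ 2) = t * f := by rw [etf, eP]; ring
      have e3 : P - h = f := by rw [eP]; ring
      rw [e1, e2, e3, eQ]
      simp only [map_pow, map_sub, Polynomial.aeval_X, Polynomial.aeval_C, hp]
      rw [show h - P = -f by rw [eP]; ring]
      ring)
  rw [pkNum_deg, Polynomial.natDegree_pow, Polynomial.natDegree_X_sub_C] at this
  exact this

/-- For every subfield `k` of `ℝ`, the function field `k(x, y)` has dimension
exactly `6` as a vector space over its subfield `k(P, Q)` generated by the components of
the Pinchuk map `F = (P, Q)` (even though `F` is generically two-to-one as a map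
`ℝ² → ℝ²`). -/
theorem pinchuk_extension_degree_six (k : Subfield ℝ) :
    Module.finrank
      (IntermediateField.adjoin (↥k)
        ({algebraMap (MvPolynomial (Fin 2) ↥k) (FractionRing (MvPolynomial (Fin 2) ↥k))
            (pinchukP ↥k),
          algebraMap (MvPolynomial (Fin 2) ↥k) (FractionRing (MvPolynomial (Fin 2) ↥k))
            (pinchukQ ↥k)} : Set (FractionRing (MvPolynomial (Fin 2) ↥k))))
      (FractionRing (MvPolynomial (Fin 2) ↥k)) = 6 := by
  exact pk_main k
end
end
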